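/- arXiv:1805.03097 — 3 statements merged into one kernel-verified Lean document; each statement's English description precedes it below -/
import Mathlib

section
/- Let q ≥ 13 be an odd prime power and let φ = f/g ∈ F_q(x) be a separable rational function of degree 3, with f, g ∈ F_q[x] coprime. Let Δ(t) ∈ F_q[t] be the discriminant of f(x) − t·g(x) regarded as a cubic polynomial in x. Then φ is a permutation rational function of P¹(F_q) if and only if there exist a non-square u ∈ F_q and a polynomial r(t) ∈ F_q[t] such that Δ(t) = u·r(t)². -/
open Polynomial

noncomputable section

open scoped Classical in
/-- The self-map of `ℙ¹(F) = F ∪ {∞}` (encoded as `Option F`, with `none` = `∞`)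
induced by the rational function `f/g`, where `f, g` are coprime polynomials. -/
def ratEval {F : Type} [Field F] (f g : F[X]) : Option F → Option F := fun x =>
  match x with
  | some a => if g.eval a ≠ 0 then some (f.eval a / g.eval a) else none
  | none =>
      if g.natDegree < f.natDegree then none
      else if f.natDegree < g.natDegree then some 0
      else some (f.leadingCoeff / g.leadingCoeff)

/-- The polynomial `f(x) - t·g(x)` over the rational function field `F(t)`. -/
def fiberPoly {F : Type} [Field F] (f g : F[X]) : Polynomial (RatFunc F) :=
  f.map (algebraMap F (RatFunc F)) - Polynomial.C RatFunc.X * g.map (algebraMap F (RatFunc F))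

/-- The discriminant of the cubic `f(x) - t·g(x)`, as a polynomial in `t`. -/
def fiberDisc {F : Type} [Field F] (f g : F[X]) : F[X] :=
  let a : ℕ → F[X] := fun i => Polynomial.C (f.coeff i) - X * Polynomial.C (g.coeff i)
  18 * a 3 * a 2 * a 1 * a 0 - 4 * (a 2) ^ 3 * a 0 + (a 2) ^ 2 * (a 1) ^ 2
    - 4 * a 3 * (a 1) ^ 3 - 27 * (a 3) ^ 2 * (a 0) ^ 2

/-- A quadratic relation satisfied by `X ^ q` with coefficients of degree less than `q` is trivial. -/
theorem eq_zero_of_quadratic_X_pow {F : Type} [Field F] {q : ℕ} {c₀ c₁ c₂ : F[X]}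
    (h₀ : c₀.natDegree < q) (h₁ : c₁.natDegree < q)
    (h : c₂ * (X ^ q) ^ 2 + c₁ * X ^ q + c₀ = 0) : c₂ = 0 ∧ c₁ = 0 ∧ c₀ = 0 := by
  have key : ∀ c e : F[X], c.natDegree < q → c + e * X ^ q = 0 → c = 0 ∧ e = 0 := by
    intro c e hc hce
    have hc0 : c = 0 := by
      have hdvd : (X : F[X]) ^ q ∣ c := ⟨-e, by linear_combination hce⟩
      by_contra hne
      have := natDegree_le_of_dvd hdvd hne
      rw [natDegree_X_pow] at this
      omega
    refine ⟨hc0, ?_⟩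
    rw [hc0, zero_add] at hce
    exact (mul_eq_zero.1 hce).resolve_right (pow_ne_zero _ X_ne_zero)
  obtain ⟨hc₀, he⟩ := key c₀ (c₂ * X ^ q + c₁) h₀ (by linear_combination h)
  obtain ⟨hc₁, hc₂⟩ := key c₁ c₂ h₁ (by linear_combination he)
  exact ⟨hc₂, hc₁, hc₀⟩

theorem prod_X_sub_C_eq_X_pow_card_sub_X (F : Type) [Field F] [Fintype F] :
    ∏ a : F, (X - C a) = X ^ Fintype.card F - (X : F[X]) := by
  have hroots := FiniteField.roots_X_pow_card_sub_X F
  have hdeg := FiniteField.X_pow_card_sub_X_natDegree_eq F (Fintype.one_lt_card (α := F))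
  have := prod_multiset_X_sub_C_of_monic_of_roots_card_eq
    (p := X ^ Fintype.card F - (X : F[X])) ?_ ?_
  · rw [hroots] at this
    exact this
  · apply monic_X_pow_sub
    rw [degree_X]
    exact_mod_cast Fintype.one_lt_card (α := F)
  · rw [hroots, hdeg]
    rfl

/-- An irreducible cubic over a finite field has non-zero square discriminant. -/
theorem exists_sq_eq_discr_of_irreducible {F : Type} [Field F] [Finite F]
    {P : Cubic F} (ha : P.a ≠ 0) (hP : Irreducible P.toPoly) :
    P.discr ≠ 0 ∧ ∃ v : F, v ^ 2 = P.discr := by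
  have : Fact (Irreducible P.toPoly) := ⟨hP⟩
  have hfin : Module.Finite F (AdjoinRoot P.toPoly) :=
    (AdjoinRoot.powerBasis hP.ne_zero).finite
  have : Finite (AdjoinRoot P.toPoly) := Module.finite_of_finite F
  have hrank : Module.finrank F (AdjoinRoot P.toPoly) = 3 := by
    rw [(AdjoinRoot.powerBasis hP.ne_zero).finrank, AdjoinRoot.powerBasis_dim,
      Cubic.natDegree_of_a_ne_zero ha]
  have hsplit : (P.toPoly.map (algebraMap F (AdjoinRoot P.toPoly))).Splits := by
    have hroot : aeval (AdjoinRoot.root P.toPoly) P.toPoly = 0 := by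
      rw [AdjoinRoot.aeval_eq, AdjoinRoot.mk_self]
    have := congrArg (map (algebraMap F (AdjoinRoot P.toPoly)))
      (minpoly.Irreducible.eq_minpoly hP hroot)
    rw [this, Polynomial.map_mul, map_C]
    exact (Normal.splits inferInstance _).C_mul _
  have hdiscr : P.discr ≠ 0 := by
    rw [Cubic.discr_ne_zero_iff_roots_nodup ha hsplit, Cubic.map_roots]
    exact nodup_roots (PerfectField.separable_of_irreducible hP).map
  refine ⟨hdiscr, ?_⟩
  obtain ⟨x, y, z, h3⟩ := (Cubic.splits_iff_roots_eq_three ha).1 hsplit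
  have hsq := Cubic.discr_eq_prod_three_roots ha h3
  by_contra! hno
  have hirr : Irreducible (X ^ 2 - C P.discr) := by
    apply irreducible_of_degree_le_three_of_not_isRoot
    · rw [natDegree_X_pow_sub_C]; decide
    · intro v hv
      apply hno v
      simpa [sub_eq_zero] using hv
  have := hirr.natDegree_dvd_finrank (L := AdjoinRoot P.toPoly) (by
    rw [Polynomial.map_sub, Polynomial.map_pow, map_X, map_C, hsq, C_pow, sq_sub_sq]
    exact (Splits.X_add_C _).mul (Splits.X_sub_C _))
  rw [natDegree_X_pow_sub_C, hrank] at this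
  omega

/-- The point `x` of `ℙ¹(F)` is a zero of the binary cubic form homogenizing `P`. -/
def Cubic.IsProjRoot {F : Type} [Field F] (P : Cubic F) : Option F → Prop
  | some x => P.a * x ^ 3 + P.b * x ^ 2 + P.c * x + P.d = 0
  | none => P.a = 0

theorem Cubic.exists_isProjRoot {F : Type} [Field F] [Finite F] {P : Cubic F} {u v : F}
    (hu : ¬ ∃ w : F, w ^ 2 = u) (h : P.discr = u * v ^ 2) : ∃ x, P.IsProjRoot x := by
  by_contra! hno
  have ha : P.a ≠ 0 := hno none
  have hirr : Irreducible P.toPoly := by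
    apply irreducible_of_degree_le_three_of_not_isRoot
    · rw [natDegree_of_a_ne_zero ha]; decide
    · intro x hx
      apply hno (some x)
      simpa [Cubic.toPoly, Cubic.IsProjRoot] using hx
  obtain ⟨hne, w, hw⟩ := exists_sq_eq_discr_of_irreducible ha hirr
  have hv : v ≠ 0 := by
    rintro rfl
    exact hne (by rw [h]; ring)
  refine hu ⟨w / v, ?_⟩
  rw [div_pow, hw, h]
  field_simp

theorem exists_ne_quadratic_roots {F : Type} [Field F] (h2 : (2 : F) ≠ 0) {p m n w : F}
    (hp : p ≠ 0) (hw : w ≠ 0) (h : m ^ 2 - 4 * p * n = w ^ 2) :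
    ∃ x y : F, x ≠ y ∧ p * x ^ 2 + m * x + n = 0 ∧ p * y ^ 2 + m * y + n = 0 := by
  refine ⟨(-m + w) / (2 * p), (-m - w) / (2 * p), ?_, ?_, ?_⟩
  · intro h
    rw [div_left_inj' (mul_ne_zero h2 hp)] at h
    exact mul_ne_zero h2 hw (by linear_combination h)
  · field_simp
    linear_combination -h
  · field_simp
    linear_combination -h

theorem Cubic.eq_zero_of_discr_eq_sq {F : Type} [Field F] (h2 : (2 : F) ≠ 0)
    {P : Cubic F} (hP : ∃! x, P.IsProjRoot x) {v : F} (h : v ^ 2 = P.discr) : v = 0 := by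
  by_contra hv
  obtain ⟨x, hx, huniq⟩ := hP
  obtain ⟨a, b, c, d⟩ := P
  have huniq' : ∀ y z, Cubic.IsProjRoot ⟨a, b, c, d⟩ y → Cubic.IsProjRoot ⟨a, b, c, d⟩ z → y = z :=
    fun y z hy hz ↦ (huniq y hy).trans (huniq z hz).symm
  cases x with
  | none =>
    obtain rfl : a = 0 := hx
    have hd : v ^ 2 = b ^ 2 * (c ^ 2 - 4 * b * d) := by
      rw [h, Cubic.discr]; ring
    have hb : b ≠ 0 := by
      rintro rfl
      exact hv (pow_eq_zero_iff two_ne_zero |>.1 (by rw [hd]; ring))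
    obtain ⟨y, _, _, hy, _⟩ := exists_ne_quadratic_roots (m := c) (n := d) (w := v / b) h2 hb
      (div_ne_zero hv hb) (by rw [div_pow, hd]; field_simp)
    have := huniq' (some y) none (by simpa [Cubic.IsProjRoot] using hy) rfl
    simp at this
  | some r =>
    have hr : a * r ^ 3 + b * r ^ 2 + c * r + d = 0 := hx
    obtain ⟨m, hm⟩ : ∃ m, m = b + a * r := ⟨_, rfl⟩
    obtain ⟨n, hn⟩ : ∃ n, n = c + m * r := ⟨_, rfl⟩
    obtain ⟨k, hk⟩ : ∃ k, k = a * r ^ 2 + m * r + n := ⟨_, rfl⟩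
    have hb : b = m - a * r := by rw [hm]; ring
    have hc : c = n - m * r := by rw [hn]; ring
    have hd0 : d = - n * r := by linear_combination hr - r ^ 2 * hb - r * hc
    subst hb hc hd0
    have hd : v ^ 2 = k ^ 2 * (m ^ 2 - 4 * a * n) := by
      rw [h, Cubic.discr, hk]; ring
    have hk0 : k ≠ 0 := by
      intro hk0
      exact hv (pow_eq_zero_iff two_ne_zero |>.1 (by rw [hd, hk0]; ring))
    have ha : a ≠ 0 := by
      intro ha
      have := huniq' (some r) none hx ha
      simp at this
    obtain ⟨y, z, hyz, hy, hz⟩ := exists_ne_quadratic_roots (m := m) (n := n) (w := v / k) h2 ha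
      (div_ne_zero hv hk0) (by rw [div_pow, hd]; field_simp)
    apply hyz
    refine Option.some_injective _ (huniq' (some y) (some z) ?_ ?_)
    · simp only [Cubic.IsProjRoot]
      linear_combination (y - r) * hy
    · simp only [Cubic.IsProjRoot]
      linear_combination (z - r) * hz

/-- If `B` takes the same values as `D` on `F`, `N` takes the opposite values, and `B² - N²` is
divisible by `(X ^ q - X) ^ 2`, then so is `B + N`, up to simple factors at the roots of `D`. -/
theorem exists_prod_roots_mul_eq {F : Type} [Field F] [Fintype F] [DecidableEq F]
    (h2 : (2 : F) ≠ 0) {D B N G : F[X]} (hD : D ≠ 0) (hB : ∀ t, B.eval t = D.eval t)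
    (hN : ∀ t, N.eval t = - D.eval t)
    (hBN : (B + N) * (B - N) = (X ^ Fintype.card F - X) ^ 2 * G) :
    ∃ A Z : F[X], Z.natDegree ≤ D.natDegree ∧ (∀ t, D.eval t ≠ 0 → Z.eval t ≠ 0) ∧
      (X ^ Fintype.card F - X) ^ 2 * A = (B + N) * Z := by
  set s : Finset F := D.roots.toFinset with hs
  have hmem : ∀ t, t ∈ s ↔ D.eval t = 0 := fun t ↦ by simp [hs, hD]
  set Z : F[X] := ∏ a ∈ s, (X - C a) with hZ
  set V : F[X] := ∏ a ∈ sᶜ, (X - C a) with hV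
  have hZV : Z * V = X ^ Fintype.card F - X := by
    rw [hZ, hV, Finset.prod_mul_prod_compl, prod_X_sub_C_eq_X_pow_card_sub_X]
  have hdvdZ : Z ∣ B + N := by
    apply Finset.prod_dvd_of_coprime
    · intro a _ b _ hab
      exact isCoprime_X_sub_C_of_isUnit_sub (sub_ne_zero.2 hab).isUnit
    · intro a _
      rw [dvd_iff_isRoot, IsRoot, eval_add, hB, hN, add_neg_cancel]
  have hcop : IsCoprime (V ^ 2) (B - N) := by
    apply IsCoprime.pow_left
    apply IsCoprime.prod_left
    intro a ha
    rw [(irreducible_X_sub_C a).coprime_iff_not_dvd, dvd_iff_isRoot, IsRoot, eval_sub, hB, hN]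
    rw [Finset.mem_compl, hmem] at ha
    intro h
    exact mul_ne_zero h2 ha (by linear_combination h)
  have hdvdV : V ^ 2 ∣ B + N :=
    hcop.dvd_of_dvd_mul_right (hBN ▸ ⟨Z ^ 2 * G, by rw [← hZV]; ring⟩)
  have hZVcop : IsCoprime Z (V ^ 2) := by
    apply IsCoprime.pow_right
    apply IsCoprime.prod_left
    intro a ha
    apply IsCoprime.prod_right
    intro b hb
    refine isCoprime_X_sub_C_of_isUnit_sub (sub_ne_zero.2 ?_).isUnit
    rintro rfl
    exact Finset.mem_compl.1 hb ha
  obtain ⟨A, hA⟩ := hZVcop.mul_dvd hdvdZ hdvdV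
  refine ⟨A, Z, ?_, ?_, ?_⟩
  · rw [hZ, natDegree_prod _ _ fun a _ ↦ X_sub_C_ne_zero a]
    simp only [natDegree_X_sub_C, Finset.sum_const, smul_eq_mul, mul_one]
    exact (Multiset.toFinset_card_le _).trans D.card_roots'
  · intro t ht
    rw [hZ, eval_prod, Finset.prod_ne_zero_iff]
    intro a ha
    rw [eval_sub, eval_X, eval_C, sub_ne_zero]
    rintro rfl
    exact ht ((hmem _).1 ha)
  · rw [← hZV, hA]; ring

theorem FiniteField.pow_half_succ_eq_neg {F : Type} [Field F] [Fintype F]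
    (hodd : Odd (Fintype.card F)) {x : F} (hx : ∀ v : F, v ^ 2 = x → v = 0) :
    x ^ ((Fintype.card F + 1) / 2) = -x := by
  have hchar : ringChar F ≠ 2 := by
    rw [Ne, FiniteField.even_card_iff_char_two, Nat.odd_iff.1 hodd]
    decide
  have hexp : (Fintype.card F + 1) / 2 = Fintype.card F / 2 + 1 := by
    obtain ⟨k, hk⟩ := hodd
    omega
  by_cases h0 : x = 0
  · rw [h0, hexp]; simp
  · have hns : ¬ IsSquare x := by
      rintro ⟨v, rfl⟩
      exact h0 (by rw [hx v (sq v), mul_zero])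
    rw [FiniteField.isSquare_iff hchar h0] at hns
    rw [hexp, pow_succ, (FiniteField.pow_dichotomy hchar h0).resolve_left hns]
    ring

/-- A non-zero polynomial of degree at most four all of whose values on `ℙ¹(F)` are zero or
non-squares is a non-square times the square of a polynomial. -/
theorem exists_eq_C_mul_sq_of_values_nonsquare {F : Type} [Field F] [Fintype F]
    (hq : 13 ≤ Fintype.card F) (hodd : Odd (Fintype.card F)) {D : F[X]} (hD : D ≠ 0)
    (hdeg : D.natDegree ≤ 4) (hval : ∀ t v : F, v ^ 2 = D.eval t → v = 0)
    (htop : ∀ v : F, v ^ 2 = D.coeff 4 → v = 0) :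
    ∃ u : F, (¬ ∃ v : F, v ^ 2 = u) ∧ ∃ r : F[X], D = C u * r ^ 2 := by
  classical
  have hchar : ringChar F ≠ 2 := by
    rw [Ne, FiniteField.even_card_iff_char_two, Nat.odd_iff.1 hodd]
    decide
  have h2 : (2 : F) ≠ 0 := Ring.two_ne_zero hchar
  obtain ⟨a, b, c, d, e, ha, hDeq⟩ : ∃ a b c d e : F, a = D.coeff 4 ∧
      D = C a * X ^ 4 + 2 * C b * X ^ 3 + C c * X ^ 2 + 2 * C d * X + C e := by
    refine ⟨D.coeff 4, D.coeff 3 / 2, D.coeff 2, D.coeff 1 / 2, D.coeff 0, rfl, ?_⟩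
    have hC : ∀ x : F, 2 * C (x / 2) = C x := fun x ↦ by
      rw [← C_ofNat, ← C_mul, mul_div_cancel₀ _ h2]
    rw [hC, hC]
    conv_lhs => rw [D.as_sum_range_C_mul_X_pow' (n := 5) (by omega)]
    simp only [Finset.sum_range_succ, Finset.sum_range_zero]
    ring
  set q := Fintype.card F with hqdef
  obtain ⟨m, hm⟩ : ∃ m, m = (q + 1) / 2 := ⟨_, rfl⟩
  have hm2 : 2 * m = q + 1 := by
    obtain ⟨k, hk⟩ := hodd
    omega
  -- the Frobenius point `T = X ^ q`
  obtain ⟨T, hT⟩ : ∃ T : F[X], T = X ^ q := ⟨_, rfl⟩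
  have hTeval : ∀ t, T.eval t = t := fun t ↦ by
    rw [hT, eval_pow, eval_X, hqdef, FiniteField.pow_card]
  have hDT : D ^ q = C a * T ^ 4 + 2 * C b * T ^ 3 + C c * T ^ 2 + 2 * C d * T + C e := by
    rw [hqdef, ← FiniteField.expand_card, ← hqdef, hT]
    conv_lhs => rw [hDeq]
    simp only [map_add, map_mul, map_pow, expand_C, expand_X, map_ofNat]
  set B : F[X] := C a * X ^ 2 * T ^ 2 + C b * X * T * (X + T) + C c * X * T + C d * (X + T) + C e
    with hB
  set g₂ : F[X] := C (b ^ 2 - a * c) * X ^ 2 - C (2 * a * d) * X - C (a * e) with hg₂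
  set g₁ : F[X] := - C (2 * a * d) * X ^ 2 - C (2 * a * e + 2 * b * d) * X - C (2 * b * e) with hg₁
  set g₀ : F[X] := - C (a * e) * X ^ 2 - C (2 * b * e) * X + C (d ^ 2 - c * e) with hg₀
  have hnorm : (B + D ^ m) * (B - D ^ m) = (X ^ q - X) ^ 2 * (g₂ * T ^ 2 + g₁ * T + g₀) := by
    have : (D ^ m) ^ 2 = D * D ^ q := by
      rw [← pow_mul, mul_comm m, hm2, pow_succ, mul_comm]
    rw [← sq_sub_sq, this, hDT, ← hT, hB, hg₂, hg₁, hg₀]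
    nth_rewrite 1 [hDeq]
    simp only [C_sub, C_add, C_mul, C_pow, C_ofNat]
    ring
  obtain ⟨A, Z, hZdeg, hZne, hAZ⟩ := exists_prod_roots_mul_eq h2 hD
    (B := B) (N := D ^ m) (fun t ↦ by
      rw [hB, hDeq]
      simp only [eval_add, eval_mul, eval_pow, eval_C, eval_X, hTeval, eval_ofNat]
      ring)
    (fun t ↦ by
      rw [eval_pow, hm]
      exact FiniteField.pow_half_succ_eq_neg hodd (hval t)) hnorm
  have hBNdeg : (B + D ^ m).natDegree ≤ 2 * q + 1 := by
    have hR : (C b * X * T * (X + T) + C c * X * T + C d * (X + T) + C e).natDegree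
        ≤ 2 * q + 1 := by
      rw [hT]
      compute_degree
      omega
    have hlead : a + a ^ m = 0 := by
      rw [hm, FiniteField.pow_half_succ_eq_neg hodd (ha ▸ htop), add_neg_cancel]
    have htop : (C a * X ^ (2 * q + 2) + D ^ m).natDegree ≤ 2 * q + 1 := by
      have hDm : (D ^ m).natDegree ≤ 2 * q + 2 := natDegree_pow_le.trans (by nlinarith)
      rw [natDegree_le_iff_coeff_eq_zero]
      intro N hN
      obtain rfl | hN' := (show 2 * q + 2 ≤ N from hN).eq_or_lt
      · have := coeff_pow_of_natDegree_le hdeg (m := m)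
        rw [show m * 4 = 2 * q + 2 by omega] at this
        rw [coeff_add, coeff_C_mul, coeff_X_pow_self, mul_one, this, ← ha, hlead]
      · rw [coeff_add, coeff_C_mul, coeff_X_pow, if_neg hN'.ne', mul_zero, zero_add,
          coeff_eq_zero_of_natDegree_lt (hDm.trans_lt hN')]
    have : B + D ^ m = (C a * X ^ (2 * q + 2) + D ^ m) +
        (C b * X * T * (X + T) + C c * X * T + C d * (X + T) + C e) := by
      rw [hB, hT]; ring
    rw [this]
    exact natDegree_add_le_of_degree_le htop hR
  have hWdeg : ((X ^ q - X : F[X]) ^ 2).natDegree = 2 * q := by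
    rw [natDegree_pow, FiniteField.X_pow_card_sub_X_natDegree_eq F (by omega)]
  have hW : (X ^ q - X : F[X]) ^ 2 ≠ 0 := by
    intro h
    rw [h] at hWdeg
    simp at hWdeg
    omega
  have hAdeg : A.natDegree ≤ 5 := by
    by_cases hA : A = 0
    · simp [hA]
    have := congrArg natDegree hAZ
    rw [natDegree_mul hW hA, hWdeg] at this
    have := (natDegree_mul_le (p := B + D ^ m) (q := Z))
    omega
  set c₂ : F[X] := A ^ 2 - 2 * (C a * X ^ 2 + C b * X) * A * Z + g₂ * Z ^ 2 with hc₂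
  set c₁ : F[X] := - 2 * X * A ^ 2 - 2 * (C b * X ^ 2 + C c * X + C d) * A * Z + g₁ * Z ^ 2 with hc₁
  set c₀ : F[X] := X ^ 2 * A ^ 2 - 2 * (C d * X + C e) * A * Z + g₀ * Z ^ 2 with hc₀
  have hquad : c₂ * (X ^ q) ^ 2 + c₁ * X ^ q + c₀ = 0 := by
    apply (mul_eq_zero.1 (?_ : (X ^ q - X : F[X]) ^ 2 * _ = 0)).resolve_left hW
    rw [← hT] at hAZ hnorm ⊢
    rw [hc₂, hc₁, hc₀]
    generalize D ^ m = N at hAZ hnorm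
    clear_value g₂ g₁ g₀
    rw [hB] at hAZ hnorm
    linear_combination ((T - X) ^ 2 * A + (B + N) * Z - 2 * B * Z) * hAZ - Z ^ 2 * hnorm
  obtain ⟨z₂, z₁, z₀⟩ :=
    eq_zero_of_quadratic_X_pow (by
    rw [hc₀, hg₀]
    compute_degree
    omega) (by
    rw [hc₁, hg₁]
    compute_degree
    omega) hquad
  obtain ⟨t, ht⟩ : ∃ t, D.eval t ≠ 0 := by
    by_contra! h
    exact hD (eq_zero_of_natDegree_lt_card_of_eval_eq_zero D Function.injective_id h (by omega))
  have hζ : Z.eval t ≠ 0 := hZne t ht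
  refine ⟨D.eval t, fun ⟨v, hv⟩ ↦ ht (by rw [← hv, hval t v hv]; ring),
    C (Z.eval t * D.eval t)⁻¹ * ((C t - X) ^ 2 * C (A.eval t) - (C a * C t ^ 2 * X ^ 2 +
      C b * C t * X * (C t + X) + C c * C t * X + C d * (C t + X) + C e) * C (Z.eval t)), ?_⟩
  have y₂ := congrArg (fun p : F[X] ↦ C (p.eval t)) z₂
  have y₁ := congrArg (fun p : F[X] ↦ C (p.eval t)) z₁
  have y₀ := congrArg (fun p : F[X] ↦ C (p.eval t)) z₀
  have hDt : C (D.eval t) = C a * C t ^ 4 + 2 * C b * C t ^ 3 + C c * C t ^ 2 + 2 * C d * C t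
      + C e := by
    rw [hDeq]
    simp only [eval_add, eval_mul, eval_pow, eval_C, eval_X, eval_ofNat, C_add, C_mul, C_pow,
      C_ofNat]
  simp only [hc₂, hc₁, hc₀, hg₂, hg₁, hg₀, eval_add, eval_sub, eval_neg, eval_mul, eval_pow,
    eval_C, eval_X, eval_ofNat, eval_zero, C_add, C_sub, C_neg, C_mul, C_pow, C_ofNat, C_0]
    at y₂ y₁ y₀
  have hinv : C (Z.eval t * D.eval t)⁻¹ * (C (Z.eval t) * C (D.eval t)) = 1 := by
    rw [← C_mul, ← C_mul, inv_mul_cancel₀ (mul_ne_zero hζ ht), C_1]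
  have key : C (D.eval t) * C (Z.eval t) ^ 2 * D = ((C t - X) ^ 2 * C (A.eval t) -
      (C a * C t ^ 2 * X ^ 2 + C b * C t * X * (C t + X) + C c * C t * X + C d * (C t + X) + C e) *
        C (Z.eval t)) ^ 2 := by
    rw [hDt]
    nth_rewrite 1 [hDeq]
    linear_combination - (C t - X) ^ 2 * (X ^ 2 * y₂ + X * y₁ + y₀)
  linear_combination C (D.eval t) * C (Z.eval t * D.eval t)⁻¹ ^ 2 * key -
    D * (C (Z.eval t * D.eval t)⁻¹ * (C (Z.eval t) * C (D.eval t)) + 1) * hinv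

/-- The binary cubic form cutting out the fibre of `f / g` over a point of `ℙ¹(F)`. -/
def fiberCubic {F : Type} [Field F] (f g : F[X]) : Option F → Cubic F
  | some t => ⟨f.coeff 3 - t * g.coeff 3, f.coeff 2 - t * g.coeff 2, f.coeff 1 - t * g.coeff 1,
      f.coeff 0 - t * g.coeff 0⟩
  | none => ⟨g.coeff 3, g.coeff 2, g.coeff 1, g.coeff 0⟩

theorem eval_eq_of_natDegree_le_three {F : Type} [Field F] {f : F[X]} (hf : f.natDegree ≤ 3)
    (x : F) :
    f.eval x = f.coeff 3 * x ^ 3 + f.coeff 2 * x ^ 2 + f.coeff 1 * x + f.coeff 0 := by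
  rw [eval_eq_sum_range' (Nat.lt_succ_of_le hf)]
  simp only [Finset.sum_range_succ, Finset.sum_range_zero]
  ring

theorem ratEval_eq_iff_isProjRoot {F : Type} [Field F] {f g : F[X]} (hco : IsCoprime f g)
    (hdeg : max f.natDegree g.natDegree = 3) (x y : Option F) :
    ratEval f g x = y ↔ (fiberCubic f g y).IsProjRoot x := by
  have hf : f.natDegree ≤ 3 := hdeg ▸ le_max_left _ _
  have hg : g.natDegree ≤ 3 := hdeg ▸ le_max_right _ _
  cases x with
  | some x =>
    have hfx := eval_eq_of_natDegree_le_three hf x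
    have hgx := eval_eq_of_natDegree_le_three hg x
    have hne : ¬ (f.eval x = 0 ∧ g.eval x = 0) := by
      rintro ⟨h₁, h₂⟩
      obtain ⟨a, b, hab⟩ := hco
      have := congrArg (eval x) hab
      simp [h₁, h₂] at this
    cases y with
    | none =>
      simp only [ratEval, fiberCubic, Cubic.IsProjRoot, ← hgx]
      by_cases h : g.eval x = 0 <;> simp [h]
    | some t =>
      have : (fiberCubic f g (some t)).IsProjRoot (some x) ↔ f.eval x = t * g.eval x := by
        simp only [fiberCubic, Cubic.IsProjRoot, hfx, hgx]
        constructor <;> intro h <;> linear_combination h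
      rw [this]
      by_cases h : g.eval x = 0
      · simpa [ratEval, h] using fun h' ↦ hne ⟨h', h⟩
      · simp [ratEval, h, div_eq_iff h]
  | none =>
    rcases lt_trichotomy g.natDegree f.natDegree with h | h | h
    · have hf3 : f.natDegree = 3 := by omega
      have hf0 : f.coeff 3 ≠ 0 := by
        rw [← hf3]
        exact leadingCoeff_ne_zero.2 (ne_zero_of_natDegree_gt h)
      have hg0 : g.coeff 3 = 0 := coeff_eq_zero_of_natDegree_lt (by omega)
      cases y <;> simp [ratEval, fiberCubic, Cubic.IsProjRoot, h, hf0, hg0]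
    · have hg3 : g.natDegree = 3 := by omega
      have hg0 : g.coeff 3 ≠ 0 := by
        rw [← hg3]
        exact leadingCoeff_ne_zero.2 (ne_zero_of_natDegree_gt (hg3 ▸ three_pos))
      cases y with
      | none => simp [ratEval, fiberCubic, Cubic.IsProjRoot, h, hg0]
      | some t =>
        simp [ratEval, fiberCubic, Cubic.IsProjRoot, leadingCoeff, ← h, hg3, div_eq_iff hg0,
          sub_eq_zero]
    · have hg3 : g.natDegree = 3 := by omega
      have hg0 : g.coeff 3 ≠ 0 := by
        rw [← hg3]
        exact leadingCoeff_ne_zero.2 (ne_zero_of_natDegree_gt h)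
      have hf0 : f.coeff 3 = 0 := coeff_eq_zero_of_natDegree_lt (by omega)
      cases y <;> simp [ratEval, fiberCubic, Cubic.IsProjRoot, h, h.not_gt, hf0, hg0, eq_comm]

theorem natDegree_fiberDisc_le {F : Type} [Field F] (f g : F[X]) :
    (fiberDisc f g).natDegree ≤ 4 := by
  simp only [fiberDisc]
  compute_degree

theorem eval_fiberDisc {F : Type} [Field F] (f g : F[X]) (t : F) :
    (fiberDisc f g).eval t = (fiberCubic f g (some t)).discr := by
  simp only [fiberDisc, fiberCubic, Cubic.discr, eval_add, eval_sub, eval_mul, eval_pow, eval_C,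
    eval_X, eval_ofNat]
  ring

theorem coeff_four_fiberDisc {F : Type} [Field F] (f g : F[X]) :
    (fiberDisc f g).coeff 4 = (fiberCubic f g none).discr := by
  simp only [fiberDisc, fiberCubic, Cubic.discr]
  compute_degree
  · ring
  all_goals simp

theorem stmt_4 (F : Type) [Field F] [Fintype F] (hq : 13 ≤ Fintype.card F)
    (hodd : Odd (Fintype.card F))
    (f g : F[X]) (hco : IsCoprime f g) (hdeg : max f.natDegree g.natDegree = 3)
    (hsep : (fiberPoly f g).Separable) :
    Function.Bijective (ratEval f g) ↔
      ∃ u : F, (¬ ∃ v : F, v ^ 2 = u) ∧ ∃ r : F[X], fiberDisc f g = Polynomial.C u * r ^ 2 := by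
  have hchar : ringChar F ≠ 2 := by
    rw [Ne, FiniteField.even_card_iff_char_two, Nat.odd_iff.1 hodd]
    decide
  constructor
  · intro hbij
    have hroot : ∀ y, ∃! x, (fiberCubic f g y).IsProjRoot x := fun y ↦ by
      simpa only [ratEval_eq_iff_isProjRoot hco hdeg] using hbij.existsUnique y
    by_cases hD : fiberDisc f g = 0
    · obtain ⟨u, hu⟩ := FiniteField.exists_nonsquare hchar
      exact ⟨u, fun ⟨v, hv⟩ ↦ hu ⟨v, by rw [← hv, sq]⟩, 0, by rw [hD]; ring⟩
    have h2 : (2 : F) ≠ 0 := Ring.two_ne_zero hchar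
    refine exists_eq_C_mul_sq_of_values_nonsquare hq hodd hD (natDegree_fiberDisc_le f g) ?_ ?_
    · intro t v hv
      rw [eval_fiberDisc] at hv
      exact Cubic.eq_zero_of_discr_eq_sq h2 (hroot _) hv
    · intro v hv
      rw [coeff_four_fiberDisc] at hv
      exact Cubic.eq_zero_of_discr_eq_sq h2 (hroot _) hv
  · rintro ⟨u, hu, r, hr⟩
    have hu0 : u ≠ 0 := by
      rintro rfl
      exact hu ⟨0, by simp⟩
    have hrdeg : r.natDegree ≤ 2 := by
      have := natDegree_fiberDisc_le f g
      rw [hr, natDegree_C_mul hu0, natDegree_pow] at this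
      omega
    apply Function.Surjective.bijective_of_finite
    intro y
    simp only [ratEval_eq_iff_isProjRoot hco hdeg]
    cases y with
    | some t =>
      refine Cubic.exists_isProjRoot (v := r.eval t) hu ?_
      rw [← eval_fiberDisc, hr, eval_mul, eval_C, eval_pow]
    | none =>
      refine Cubic.exists_isProjRoot (v := r.coeff 2) hu ?_
      rw [← coeff_four_fiberDisc, hr, coeff_C_mul, ← coeff_pow_of_natDegree_le hrdeg]

end
end

section
/- Let q be an odd prime power and let φ ∈ F_q(x) be a separable permutation rational function of degree 3. Then φ is equivalent to a rational function of the form (x³ + ax)/(bx² + 1) for some a, b ∈ F_q with b ≠ 0. -/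
open Polynomial

noncomputable section

/-- Composition of rational functions: `(f/g) ∘ ψ = f(ψ)/g(ψ)`. -/
def rfComp {F : Type} [Field F] (φ ψ : RatFunc F) : RatFunc F :=
  Polynomial.aeval ψ φ.num / Polynomial.aeval ψ φ.denom

/-- A Möbius transformation `(ax + b)/(cx + d)` with `ad - bc ≠ 0`. -/
def IsMobius {F : Type} [Field F] (m : RatFunc F) : Prop :=
  ∃ a b c d : F, a * d - b * c ≠ 0 ∧
    m = (RatFunc.C a * RatFunc.X + RatFunc.C b) / (RatFunc.C c * RatFunc.X + RatFunc.C d)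

/-- Equivalence of rational functions: `φ ∼ ψ` iff `m₁ ∘ φ ∘ m₂ = ψ` for some
Möbius transformations `m₁, m₂`. -/
def RFEquiv {F : Type} [Field F] (φ ψ : RatFunc F) : Prop :=
  ∃ m₁ m₂ : RatFunc F, IsMobius m₁ ∧ IsMobius m₂ ∧ rfComp m₁ (rfComp φ m₂) = ψ

/-- A polynomial of degree less than `2 q` which vanishes doubly at all points is zero. -/
lemma Polynomial.eq_zero_of_double_zeros {F : Type} [Field F] [Fintype F] {R : F[X]}
    (hd : R.degree < (2 * Fintype.card F : ℕ)) (h0 : ∀ x, R.eval x = 0)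
    (h1 : ∀ x, (derivative R).eval x = 0) : R = 0 := by
  set q := Fintype.card F with hq
  have hq1 : 1 < q := Fintype.one_lt_card
  set θ : F[X] := X ^ q - X with hθ
  have hθd : θ.degree = q := by
    rw [hθ, degree_sub_eq_left_of_degree_lt] <;> simp [hq1]
  have hθe : ∀ x : F, θ.eval x = 0 := fun x => by simp [hθ, hq, FiniteField.pow_card]
  have key : ∀ S : F[X], S.degree < q → (∀ x, S.eval x = 0) → S = 0 := by
    intro S hS h
    apply Polynomial.eq_zero_of_degree_lt_of_eval_finset_eq_zero Finset.univ
    · simpa using hS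
    · intro x _; exact h x
  have hθm : θ.Monic := by
    rw [hθ]; exact monic_X_pow_sub (by simpa using hq1)
  have hmod : R %ₘ θ = 0 := by
    apply key
    · rw [← hθd]; exact degree_modByMonic_lt _ hθm
    · intro x
      have := congrArg (eval x) (modByMonic_add_div R θ)
      simpa [hθe, h0] using this
  have hR : R = θ * (R /ₘ θ) := by
    conv_lhs => rw [← modByMonic_add_div R θ, hmod, zero_add]
  set S := R /ₘ θ with hS
  have hS0 : S = 0 := by
    apply key
    · by_contra hc
      rw [not_lt] at hc
      have : ((2 * q : ℕ) : WithBot ℕ) ≤ R.degree := by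
        rw [hR, degree_mul, hθd, two_mul]
        push_cast
        gcongr
      exact absurd hd (not_lt.mpr this)
    · intro x
      have h := h1 x
      rw [hR] at h
      have hc : (q : F) = 0 := FiniteField.cast_card_eq_zero F
      have hθ' : derivative θ = -1 := by
        rw [hθ, derivative_sub, derivative_X_pow, hc]; simp
      simpa [derivative_mul, hθe, hθ'] using h
  rw [hR, hS0, mul_zero]

lemma Polynomial.degree_polar_sq_sub_le {F : Type} [Field F] {q : ℕ} (hq : 2 ≤ q) (a b c : F) :
    let Y : F[X] := X ^ q
    let U : F[X] := X ^ 2 * Y ^ 2 + C a * (X ^ 2 + Y ^ 2) + C b * (X + Y) + C c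
    (U * U - (X ^ 4 + C (2 * a) * X ^ 2 + C (2 * b) * X + C c)
      * (Y ^ 4 + C (2 * a) * Y ^ 2 + C (2 * b) * Y + C c)).degree
      ≤ ((4 * q + 1 : ℕ) : WithBot ℕ) := by
  intro Y U
  have hm : ∀ (r : F) (i j : ℕ), i + q * j ≤ 4 * q + 1 →
      C r * (X ^ i * Y ^ j) ∈ degreeLE F (4 * q + 1 : ℕ) := fun r i j hij => by
    rw [mem_degreeLE, ← natDegree_le_iff_degree_le]
    refine (natDegree_C_mul_le _ _).trans ((natDegree_mul_le).trans ?_)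
    rwa [← pow_mul, natDegree_X_pow, natDegree_X_pow]
  rw [← mem_degreeLE]
  convert add_mem (add_mem (add_mem (add_mem (add_mem (add_mem (add_mem (add_mem (add_mem (add_mem
    (add_mem (add_mem (add_mem
    (hm (2 * b) 3 2 (by omega)) (hm (2 * b) 2 3 (by omega))) (hm (-2 * b) 4 1 (by omega)))
    (hm (-2 * b) 1 4 (by omega))) (hm (2 * c - 2 * a ^ 2) 2 2 (by omega)))
    (hm (a ^ 2 - c) 4 0 (by omega))) (hm (a ^ 2 - c) 0 4 (by omega)))
    (hm (2 * a * b) 3 0 (by omega))) (hm (2 * a * b) 0 3 (by omega)))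
    (hm (-2 * a * b) 2 1 (by omega))) (hm (-2 * a * b) 1 2 (by omega)))
    (hm (b ^ 2) 2 0 (by omega))) (hm (b ^ 2) 0 2 (by omega))) (hm (-2 * b ^ 2) 1 1 (by omega))
    using 1
  simp only [U, C_mul, C_sub, C_pow, C_ofNat, C_neg]
  generalize Y = Z
  ring

/-- If all values of the quartic `x⁴ + 2ax² + 2bx + c` over `F_q` are nonzero squares, then its
power of exponent `(q + 1) / 2` is a symmetric biquadratic expression in `x` and `x ^ q`. -/
lemma Polynomial.pow_eq_of_quartic_values {F : Type} [Field F] [Fintype F] {k : ℕ}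
    (hk : Fintype.card F = 2 * k + 1) {a b c : F}
    (h : ∀ x : F, (x ^ 4 + 2 * a * x ^ 2 + 2 * b * x + c) ^ k = 1) {E Y : F[X]}
    (hE : E = X ^ 4 + C (2 * a) * X ^ 2 + C (2 * b) * X + C c)
    (hY : Y = X ^ Fintype.card F) :
    E ^ (k + 1) = X ^ 2 * Y ^ 2 + C a * (X ^ 2 + Y ^ 2) + C b * (X + Y) + C c := by
  have hc : (Fintype.card F : F) = 0 := FiniteField.cast_card_eq_zero F
  have hY' : derivative Y = 0 := by rw [hY, derivative_X_pow, hc]; simp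
  have hYx : ∀ x, Y.eval x = x := fun x => by simp [hY, FiniteField.pow_card]
  have hc2 : 2 * ((k : F) + 1) = 1 := by
    rw [hk] at hc; push_cast at hc; linear_combination hc
  have h2 : (2 : F) ≠ 0 := fun h => by simp [h] at hc2
  have hVV : E ^ (k + 1) * E ^ (k + 1)
      = E * (Y ^ 4 + C (2 * a) * Y ^ 2 + C (2 * b) * Y + C c) := by
    have : E ^ Fintype.card F = Y ^ 4 + C (2 * a) * Y ^ 2 + C (2 * b) * Y + C c := by
      rw [← FiniteField.expand_card]
      simp [hE, hY]
    rw [← this, ← pow_add, ← pow_succ']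
    congr 1; omega
  have hq1 : 1 < Fintype.card F := Fintype.one_lt_card
  generalize hq : Fintype.card F = q at *
  have hEd : E.degree = 4 := by rw [hE]; compute_degree!
  have hEm : E.Monic := by rw [hE]; monicity!
  have hEn : E.natDegree = 4 := natDegree_eq_of_degree_eq_some hEd
  generalize hU : X ^ 2 * Y ^ 2 + C a * (X ^ 2 + Y ^ 2) + C b * (X + Y) + C c = U
  have hUd : (U + E ^ (k + 1)).degree = (2 * q + 2 : ℕ) := by
    have hV : (E ^ (k + 1)).Monic := hEm.pow _
    have hVd : (E ^ (k + 1)).natDegree = 2 * q + 2 := by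
      rw [natDegree_pow, hEn]; omega
    have hcoef : U.coeff (2 * q + 2) = 1 := by
      have : U = X ^ (2 * q + 2) + C a * X ^ 2 + C a * X ^ (2 * q) + C b * X ^ 1 + C b * X ^ q
        + C c * X ^ 0 := by rw [← hU, hY]; ring
      rw [this]
      simp only [coeff_add, coeff_C_mul_X_pow, coeff_X_pow]
      rw [if_pos trivial, if_neg (by omega), if_neg (by omega), if_neg (by omega),
        if_neg (by omega), if_neg (by omega)]
      simp
    have hUle : U.natDegree ≤ 2 * q + 2 := by
      rw [← hU, hY]
      compute_degree
      all_goals omega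
    have hle : (U + E ^ (k + 1)).natDegree ≤ 2 * q + 2 :=
      (natDegree_add_le _ _).trans (max_le hUle hVd.le)
    have hco : (U + E ^ (k + 1)).coeff (2 * q + 2) = 2 := by
      rw [coeff_add, hcoef]
      have := hV.coeff_natDegree
      rw [hVd] at this
      rw [this]; norm_num
    apply le_antisymm
    · exact natDegree_le_iff_degree_le.mp hle
    · exact le_degree_of_ne_zero (by rw [hco]; exact h2)
  have hUV : ((U - E ^ (k + 1)) * (U + E ^ (k + 1))).degree ≤ (4 * q + 1 : ℕ) := by
    have e1 : (U - E ^ (k + 1)) * (U + E ^ (k + 1)) = U * U - E ^ (k + 1) * E ^ (k + 1) := by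
      ring
    rw [e1, hVV, ← hU, hE, hY]
    exact Polynomial.degree_polar_sq_sub_le (by omega) a b c
  symm
  rw [← sub_eq_zero]
  apply Polynomial.eq_zero_of_double_zeros
  · rw [hq]
    by_contra hcon
    rw [not_lt] at hcon
    rw [degree_mul, hUd] at hUV
    have h5 : ((2 * q : ℕ) : WithBot ℕ) + ((2 * q + 2 : ℕ) : WithBot ℕ)
        ≤ ((4 * q + 1 : ℕ) : WithBot ℕ) := le_trans (by gcongr) hUV
    have h6 : 2 * q + (2 * q + 2) ≤ 4 * q + 1 := by exact_mod_cast h5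
    omega
  · intro x
    rw [eval_sub, eval_pow, pow_succ, hE, ← hU]
    simp [hYx, h x]
    ring
  · intro x
    have hE' : (derivative E).eval x = 4 * x ^ 3 + 4 * a * x + 2 * b := by
      simp [hE]; ring
    have hEk : E.eval x ^ k = 1 := by rw [← h x, hE]; simp
    have hU' : (derivative U).eval x = 2 * x ^ 3 + 2 * a * x + b := by
      have hY2 : derivative (Y ^ 2) = 0 := by rw [derivative_pow, hY', mul_zero]
      rw [← hU]; simp [hY', hY2, hYx]; ring
    rw [derivative_sub, derivative_pow, eval_sub, hU']
    simp [hEk, hE']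
    linear_combination (-(2 * x ^ 3 + 2 * a * x + b)) * hc2

/-- If all values of the quartic `x⁴ + 2ax² + 2bx + c` over `F_q` are nonzero squares, then
its linear coefficient vanishes. -/
lemma linear_coeff_eq_zero_of_quartic_values {F : Type} [Field F] [Fintype F] {k : ℕ}
    (hk : Fintype.card F = 2 * k + 1) {a b c : F}
    (h : ∀ x : F, (x ^ 4 + 2 * a * x ^ 2 + 2 * b * x + c) ^ k = 1) : b = 0 := by
  have hV := Polynomial.pow_eq_of_quartic_values hk h rfl rfl
  have hc : (Fintype.card F : F) = 0 := FiniteField.cast_card_eq_zero F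
  have hc2 : 2 * ((k : F) + 1) = 1 := by
    rw [hk] at hc; push_cast at hc; linear_combination hc
  have h2 : (2 : F) ≠ 0 := fun h => by simp [h] at hc2
  have hq1 : 1 < Fintype.card F := Fintype.one_lt_card
  generalize hq : Fintype.card F = q at *
  have hY' : derivative (X ^ q : F[X]) = 0 := by rw [derivative_X_pow, hc]; simp
  generalize hY : (X ^ q : F[X]) = Y at *
  generalize hE : (X ^ 4 + C (2 * a) * X ^ 2 + C (2 * b) * X + C c : F[X]) = E at *
  have hE' : derivative E = 4 * X ^ 3 + C (4 * a) * X + C (2 * b) := by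
    rw [← hE]; simp [C_ofNat]; ring
  have hV' : 2 * E * derivative (E ^ (k + 1)) = E ^ (k + 1) * derivative E := by
    have : (2 : F[X]) * ((k : F[X]) + 1) = 1 := by
      have := congrArg (C : F → F[X]) hc2
      simpa only [C_mul, C_add, C_1, map_natCast, C_ofNat] using this
    rw [derivative_pow_succ]
    simp only [C_add, C_1, map_natCast]
    linear_combination (E ^ (k + 1) * derivative E) * this
  rw [hV] at hV'
  have hU' := hV'
  simp only [derivative_add, derivative_mul, hY', derivative_C,
    derivative_X, derivative_pow] at hU'
  rw [hE', ← hE] at hU'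
  have hid : C (-6 * b) * X ^ (2 * q + 2) + C (4 * a ^ 2 - 4 * c) * X ^ (2 * q + 1)
      + C (2 * a * b) * X ^ (2 * q) + C (4 * b) * X ^ (q + 3) + C (4 * a * b) * X ^ (q + 1)
      + C (2 * b ^ 2) * X ^ q + C (2 * b) * X ^ 4 + C (4 * c - 4 * a ^ 2) * X ^ 3
      + C (- 6 * a * b) * X ^ 2 + C (- 2 * b ^ 2) * X ^ 1 = (0 : F[X]) := by
    have e : ∀ i, (X : F[X]) ^ (q + i) = Y * X ^ i := fun i => by rw [pow_add, hY]
    have e' : ∀ i, (X : F[X]) ^ (2 * q + i) = Y ^ 2 * X ^ i := fun i => by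
      rw [pow_add, mul_comm 2 q, pow_mul, hY]
    have e0 := e' 0
    rw [add_zero] at e0
    rw [e', e', e0, e, e, hY]
    simp only [C_mul, C_sub, C_pow, C_ofNat, C_neg, Nat.cast_ofNat, pow_one] at hU' ⊢
    linear_combination -hU'
  have hac : 4 * a ^ 2 - 4 * c = 0 := by
    have := congrArg (fun p => coeff p (2 * q + 1)) hid
    simp only [coeff_add, coeff_C_mul_X_pow, coeff_zero] at this
    rw [if_neg (by omega), if_pos trivial, if_neg (by omega), if_neg (by omega), if_neg (by omega),
      if_neg (by omega), if_neg (by omega), if_neg (by omega), if_neg (by omega),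
      if_neg (by omega)] at this
    simpa using this
  have hac' : 4 * c - 4 * a ^ 2 = 0 := by linear_combination -hac
  have := congrArg (fun p => coeff p q) hid
  simp only [hac', coeff_add, coeff_C_mul_X_pow, coeff_zero] at this
  rw [if_neg (by omega), if_neg (by omega), if_neg (by omega), if_neg (by omega),
    if_neg (by omega), if_pos trivial, if_neg (by omega), ite_self, if_neg (by omega),
    if_neg (by omega)] at this
  simpa [h2] using this

/-- The binary cubic form attached to the coefficients of `P`. -/
def Cubic.form {F : Type} [Field F] (P : Cubic F) (x z : F) : F :=
  P.a * x ^ 3 + P.b * x ^ 2 * z + P.c * x * z ^ 2 + P.d * z ^ 3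

/-- The cubic `r P + s Q`. -/
def Cubic.comb {F : Type} [Field F] (r s : F) (P Q : Cubic F) : Cubic F :=
  ⟨r * P.a + s * Q.a, r * P.b + s * Q.b, r * P.c + s * Q.c, r * P.d + s * Q.d⟩

/-- The linear substitution `(x, z) ↦ (α x + β z, γ x + δ z)` in a binary cubic form. -/
def Cubic.subst {F : Type} [Field F] (P : Cubic F) (α β γ δ : F) : Cubic F :=
  ⟨P.a * α ^ 3 + P.b * α ^ 2 * γ + P.c * α * γ ^ 2 + P.d * γ ^ 3,
   3 * P.a * α ^ 2 * β + P.b * (α ^ 2 * δ + 2 * α * β * γ)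
     + P.c * (β * γ ^ 2 + 2 * α * γ * δ) + 3 * P.d * γ ^ 2 * δ,
   3 * P.a * α * β ^ 2 + P.b * (β ^ 2 * γ + 2 * α * β * δ)
     + P.c * (α * δ ^ 2 + 2 * β * γ * δ) + 3 * P.d * γ * δ ^ 2,
   P.a * β ^ 3 + P.b * β ^ 2 * δ + P.c * β * δ ^ 2 + P.d * δ ^ 3⟩

/-- The pair `(P, Q)` induces an injective map on the projective line. -/
def Cubic.PairInjective {F : Type} [Field F] (P Q : Cubic F) : Prop :=
  ∀ x z x' z' : F, P.form x z * Q.form x' z' = P.form x' z' * Q.form x z → x * z' = x' * z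

/-- In characteristic three, `P` and `Q` are not both cubes. -/
def Cubic.PairSeparable {F : Type} [Field F] (P Q : Cubic F) : Prop :=
  (3 : F) = 0 → ¬(P.b = 0 ∧ P.c = 0 ∧ Q.b = 0 ∧ Q.c = 0)

/-- The pair `(P, Q)` can be brought to the form `(x³ + e x z², h x² z + z³)` with `h ≠ 0`. -/
def Cubic.HasOddForm {F : Type} [Field F] (P Q : Cubic F) : Prop :=
  ∃ a b c d α β γ δ e h : F, a * d - b * c ≠ 0 ∧ α * δ - β * γ ≠ 0 ∧ h ≠ 0 ∧
    (Cubic.comb a b P Q).subst α β γ δ = ⟨1, 0, e, 0⟩ ∧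
    (Cubic.comb c d P Q).subst α β γ δ = ⟨0, h, 0, 1⟩

namespace Cubic

variable {F : Type} [Field F] {P Q : Cubic F}

lemma form_subst (P : Cubic F) (α β γ δ x z : F) :
    (P.subst α β γ δ).form x z = P.form (α * x + β * z) (γ * x + δ * z) := by
  simp only [form, subst]; ring

lemma form_comb (r s : F) (P Q : Cubic F) (x z : F) :
    (comb r s P Q).form x z = r * P.form x z + s * Q.form x z := by
  simp only [form, comb]; ring

lemma PairInjective.subst (h : PairInjective P Q) {α β γ δ : F} (hM : α * δ - β * γ ≠ 0) :
    PairInjective (P.subst α β γ δ) (Q.subst α β γ δ) := by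
  intro x z x' z' he
  simp only [form_subst] at he
  have := h _ _ _ _ he
  apply mul_left_cancel₀ hM
  linear_combination this

lemma PairInjective.comb (h : PairInjective P Q) {a b c d : F} (hM : a * d - b * c ≠ 0) :
    PairInjective (comb a b P Q) (comb c d P Q) := by
  intro x z x' z' he
  simp only [form_comb] at he
  apply h
  apply mul_left_cancel₀ hM
  linear_combination he

lemma PairSeparable.subst (h : PairSeparable P Q) {α β γ δ : F} (hM : α * δ - β * γ ≠ 0) :
    PairSeparable (P.subst α β γ δ) (Q.subst α β γ δ) := by
  rintro h3 ⟨h1, h2, h4, h5⟩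
  have h6 : (α * δ - β * γ) ^ 2 ≠ 0 := pow_ne_zero 2 hM
  simp only [Cubic.subst] at h1 h2 h4 h5
  refine h h3 ⟨?_, ?_, ?_, ?_⟩ <;> apply mul_left_cancel₀ h6
  · linear_combination δ * h1 + γ * h2
      - h3 * (δ * (P.a * α ^ 2 * β + P.d * γ ^ 2 * δ + P.b * α * β * γ + P.c * α * γ * δ)
        + γ * (P.a * α * β ^ 2 + P.d * γ * δ ^ 2 + P.b * α * β * δ + P.c * β * γ * δ))
  · linear_combination β * h1 + α * h2
      - h3 * (β * (P.a * α ^ 2 * β + P.d * γ ^ 2 * δ + P.b * α * β * γ + P.c * α * γ * δ)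
        + α * (P.a * α * β ^ 2 + P.d * γ * δ ^ 2 + P.b * α * β * δ + P.c * β * γ * δ))
  · linear_combination δ * h4 + γ * h5
      - h3 * (δ * (Q.a * α ^ 2 * β + Q.d * γ ^ 2 * δ + Q.b * α * β * γ + Q.c * α * γ * δ)
        + γ * (Q.a * α * β ^ 2 + Q.d * γ * δ ^ 2 + Q.b * α * β * δ + Q.c * β * γ * δ))
  · linear_combination β * h4 + α * h5
      - h3 * (β * (Q.a * α ^ 2 * β + Q.d * γ ^ 2 * δ + Q.b * α * β * γ + Q.c * α * γ * δ)
        + α * (Q.a * α * β ^ 2 + Q.d * γ * δ ^ 2 + Q.b * α * β * δ + Q.c * β * γ * δ))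

lemma PairSeparable.comb (h : PairSeparable P Q) {a b c d : F} (hM : a * d - b * c ≠ 0) :
    PairSeparable (comb a b P Q) (comb c d P Q) := by
  rintro h3 ⟨h1, h2, h4, h5⟩
  simp only [Cubic.comb] at h1 h2 h4 h5
  refine h h3 ⟨?_, ?_, ?_, ?_⟩ <;> apply mul_left_cancel₀ hM
  · linear_combination d * h1 - b * h4
  · linear_combination d * h2 - b * h5
  · linear_combination a * h4 - c * h1
  · linear_combination a * h5 - c * h2

lemma HasOddForm.of_comb {a b c d : F} (hM : a * d - b * c ≠ 0)
    (h : HasOddForm (comb a b P Q) (comb c d P Q)) : HasOddForm P Q := by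
  obtain ⟨a', b', c', d', α, β, γ, δ, e, k, h1, h2, h3, h4, h5⟩ := h
  refine ⟨a' * a + b' * c, a' * b + b' * d, c' * a + d' * c, c' * b + d' * d, α, β, γ, δ, e, k,
    ?_, h2, h3, ?_, ?_⟩
  · have := mul_ne_zero h1 hM
    contrapose! this
    linear_combination this
  · rw [← h4]; simp only [comb]; congr 2 <;> ring
  · rw [← h5]; simp only [comb]; congr 2 <;> ring

lemma HasOddForm.of_subst {α β γ δ : F} (hM : α * δ - β * γ ≠ 0)
    (h : HasOddForm (P.subst α β γ δ) (Q.subst α β γ δ)) : HasOddForm P Q := by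
  obtain ⟨a, b, c, d, α', β', γ', δ', e, k, h1, h2, h3, h4, h5⟩ := h
  refine ⟨a, b, c, d, α * α' + β * γ', α * β' + β * δ', γ * α' + δ * γ', γ * β' + δ * δ', e, k,
    h1, ?_, h3, ?_, ?_⟩
  · have := mul_ne_zero h2 hM
    contrapose! this
    linear_combination this
  · rw [← h4]; simp only [comb, subst]; congr 1 <;> ring
  · rw [← h5]; simp only [comb, subst]; congr 1 <;> ring

lemma hasOddForm_of_depressed_polynomial (h2 : (2 : F) ≠ 0) {e : F} (he : (3 : F) = 0 → e ≠ 0) :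
    HasOddForm (⟨1, 0, e, 0⟩ : Cubic F) ⟨0, 0, 0, 1⟩ := by
  by_cases h0 : e = 0
  · have h3 : (3 : F) ≠ 0 := fun h => he h h0
    subst h0
    refine ⟨1 / 2, 1 / 2, 1 / 2, -1 / 2, 1, 1, 1, -1, 3, 3, ?_, ?_, h3, ?_, ?_⟩
    · intro h
      field_simp at h
      exact h2 (by linear_combination -h)
    · intro h
      exact h2 (by linear_combination -h)
    · simp only [comb, subst, mk.injEq]; refine ⟨?_, ?_, ?_, ?_⟩ <;> field_simp <;> ring
    · simp only [comb, subst, mk.injEq]; refine ⟨?_, ?_, ?_, ?_⟩ <;> field_simp <;> ring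
  · refine ⟨0, 1, 1, 0, 0, 1, 1, 0, 0, e, ?_, ?_, h0, ?_, ?_⟩
    · norm_num
    · norm_num
    · simp only [comb, subst, mk.injEq]; refine ⟨?_, ?_, ?_, ?_⟩ <;> ring
    · simp only [comb, subst, mk.injEq]; refine ⟨?_, ?_, ?_, ?_⟩ <;> ring

lemma hasOddForm_of_polynomial (h2 : (2 : F) ≠ 0) {u v w : F}
    (hi : PairInjective ⟨1, u, v, w⟩ (⟨0, 0, 0, 1⟩ : Cubic F))
    (hs : PairSeparable ⟨1, u, v, w⟩ (⟨0, 0, 0, 1⟩ : Cubic F)) :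
    HasOddForm ⟨1, u, v, w⟩ (⟨0, 0, 0, 1⟩ : Cubic F) := by
  obtain ⟨s, hs1, hs2⟩ : ∃ s : F, 3 * s + u = 0 ∧ ((3 : F) = 0 → 2 * u * s + v ≠ 0) := by
    by_cases h3 : (3 : F) = 0
    · have hu : u = 0 := by
        by_contra hu
        obtain ⟨s, hs⟩ : ∃ s, v = -(2 * u * s) := ⟨-v / (2 * u), by field_simp⟩
        have h := hi s 1 (s - u) 1 (by
          simp only [form, hs]
          linear_combination h3 * (u * s * (s - u)))
        apply hu
        linear_combination h
      subst hu
      refine ⟨0, by simp, fun _ h => hs h3 ⟨rfl, by simpa using h, rfl, rfl⟩⟩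
    · exact ⟨-u / 3, by field_simp; ring, fun h => absurd h h3⟩
  apply HasOddForm.of_subst (α := 1) (β := s) (γ := 0) (δ := 1) (by simp)
  apply HasOddForm.of_comb (a := 1) (b := -(s ^ 3 + u * s ^ 2 + v * s + w)) (c := 0) (d := 1)
    (by simp)
  convert hasOddForm_of_depressed_polynomial h2 (e := 3 * s ^ 2 + 2 * u * s + v) ?_ using 1
  · simp only [comb, subst, mk.injEq]
    refine ⟨by ring, by linear_combination hs1, by ring, by ring⟩
  · simp only [comb, subst, mk.injEq]
    refine ⟨by ring, by ring, by ring, by ring⟩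
  · intro h3 h
    exact hs2 h3 (by linear_combination h - s ^ 2 * h3)

lemma PairInjective.right_ne_zero (h : PairInjective P Q) : Q ≠ ⟨0, 0, 0, 0⟩ := by
  rintro rfl
  simpa using h 1 0 0 1 (by simp [form])

lemma hasOddForm_of_quadratic [Fintype F] (hodd : Odd (Fintype.card F)) {c β n : F}
    (hi : PairInjective ⟨1, 0, c, β⟩ (⟨0, 1, 0, -n⟩ : Cubic F))
    (hs : PairSeparable ⟨1, 0, c, β⟩ (⟨0, 1, 0, -n⟩ : Cubic F)) :
    HasOddForm ⟨1, 0, c, β⟩ (⟨0, 1, 0, -n⟩ : Cubic F) := by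
  have hF : ringChar F ≠ 2 := fun h => by
    have := FiniteField.even_card_iff_char_two.mp h
    rw [← Nat.not_even_iff_odd, Nat.even_iff] at hodd
    exact hodd this
  have h2 : (2 : F) ≠ 0 := Ring.two_ne_zero hF
  have h4 : (4 : F) ≠ 0 := fun h => mul_ne_zero h2 h2 (by linear_combination h)
  have hn : ¬ IsSquare n := by
    rintro ⟨r, hr⟩
    simpa using hi 1 0 r 1 (by simp [form, hr]; ring)
  have hn0 : n ≠ 0 := fun h => hn (h ▸ IsSquare.zero)
  have hg : ∀ x : F, x ^ 2 - n ≠ 0 := fun x h => hn ⟨x, by linear_combination -h⟩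
  have hsurj : ∀ t : F, ∃ x : F, x ^ 3 + c * x + β = t * (x ^ 2 - n) := by
    have hinj : Function.Injective fun x : F => (x ^ 3 + c * x + β) / (x ^ 2 - n) := by
      intro x y hxy
      rw [div_eq_div_iff (hg x) (hg y)] at hxy
      have := hi x 1 y 1 (by simp only [form]; linear_combination hxy)
      simpa using this
    intro t
    obtain ⟨x, hx⟩ := Finite.surjective_of_injective hinj t
    exact ⟨x, by rw [← hx]; field_simp [hg x]⟩
  by_cases htriple : ∃ t x : F, x ^ 3 + c * x + β = t * (x ^ 2 - n) ∧
      IsSquare ((x - t) ^ 2 - 4 * (x ^ 2 - t * x + c))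
  · obtain ⟨t, x, hx, s, hsq⟩ := htriple
    have hroot : ∀ r : F, r ^ 2 + (x - t) * r + (x ^ 2 - t * x + c) = 0 → r = x := by
      intro r hr
      have hr' : r ^ 3 + c * r + β = t * (r ^ 2 - n) := by linear_combination (r - x) * hr + hx
      have := hi r 1 x 1 (by
        simp only [form]
        linear_combination (x ^ 2 - n) * hr' - (r ^ 2 - n) * hx)
      simpa using this
    have h1 := hroot ((-(x - t) + s) / 2) (by field_simp; linear_combination -hsq)
    have h1' := hroot ((-(x - t) - s) / 2) (by field_simp; linear_combination -hsq)
    rw [div_eq_iff h2] at h1 h1'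
    have ht : t = 3 * x := by
      apply mul_left_cancel₀ h2
      linear_combination h1 + h1'
    have hs0 : s = 0 := by
      apply mul_left_cancel₀ h2
      linear_combination h1 - h1'
    have hc : c = t * x := by
      apply mul_left_cancel₀ h4
      rw [hs0, ht] at hsq
      rw [ht]
      linear_combination -hsq
    have hβ : β = - x ^ 3 - t * n := by
      rw [hc] at hx
      rw [ht] at hx ⊢
      linear_combination hx
    have hM1 : 0 * -t - 1 / (x ^ 2 - n) * 1 ≠ 0 := by simp [hg x]
    have hM2 : x * 0 - 1 * 1 ≠ (0 : F) := by simp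
    apply HasOddForm.of_comb hM1
    apply HasOddForm.of_subst hM2
    have hi' := (hi.comb hM1).subst hM2
    have hs' := (hs.comb hM1).subst hM2
    have e1 : (comb 0 (1 / (x ^ 2 - n)) ⟨1, 0, c, β⟩ (⟨0, 1, 0, -n⟩ : Cubic F)).subst x 1 1 0
        = ⟨1, 2 * x / (x ^ 2 - n), 1 / (x ^ 2 - n), 0⟩ := by
      have := hg x
      simp only [comb, subst, mk.injEq]
      refine ⟨?_, ?_, ?_, ?_⟩ <;> field_simp <;> ring
    have e2 : (comb 1 (-t) ⟨1, 0, c, β⟩ (⟨0, 1, 0, -n⟩ : Cubic F)).subst x 1 1 0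
        = ⟨0, 0, 0, 1⟩ := by
      simp only [comb, subst, mk.injEq, hβ, hc, ht]
      refine ⟨?_, ?_, ?_, ?_⟩ <;> ring
    rw [e1, e2] at hi' hs' ⊢
    exact hasOddForm_of_polynomial h2 hi' hs'
  · push Not at htriple
    have hpow : ∀ y : F, ¬ IsSquare y → y ^ (Fintype.card F / 2) = -1 := by
      intro y hy
      have hy0 : y ≠ 0 := fun h => hy (h ▸ IsSquare.zero)
      exact (FiniteField.pow_dichotomy hF hy0).resolve_left
        fun h => hy ((FiniteField.isSquare_iff hF hy0).mpr h)
    have hsqpow : ∀ y : F, y ≠ 0 → (y ^ 2) ^ (Fintype.card F / 2) = 1 := fun y hy =>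
      (FiniteField.isSquare_iff hF (pow_ne_zero 2 hy)).mp ⟨y, sq y⟩
    have hdisc : ∀ t : F, (4 * n * t ^ 4 + 4 * β * t ^ 3 + (c ^ 2 - 27 * n ^ 2 - 18 * c * n) * t ^ 2
        - (54 * n + 18 * c) * β * t - 4 * c ^ 3 - 27 * β ^ 2) ^ (Fintype.card F / 2) = -1 := by
      intro t
      obtain ⟨x, hx⟩ := hsurj t
      have hns := htriple t x hx
      have h0 : x ^ 2 + (x - t) * x + (x ^ 2 - t * x + c) ≠ 0 := fun h =>
        hns ⟨2 * x + (x - t), by linear_combination (-4) * h⟩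
      have hβ : β = t * (x ^ 2 - n) - x ^ 3 - c * x := by linear_combination hx
      have : 4 * n * t ^ 4 + 4 * β * t ^ 3 + (c ^ 2 - 27 * n ^ 2 - 18 * c * n) * t ^ 2
          - (54 * n + 18 * c) * β * t - 4 * c ^ 3 - 27 * β ^ 2
          = ((x - t) ^ 2 - 4 * (x ^ 2 - t * x + c))
            * (x ^ 2 + (x - t) * x + (x ^ 2 - t * x + c)) ^ 2 := by
        rw [hβ]; ring
      rw [this, mul_pow, hpow _ hns, hsqpow _ h0, mul_one]
    have hβ : β = 0 := by
      obtain ⟨k, hk⟩ := id hodd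
      have hk2 : Fintype.card F / 2 = k := by omega
      rw [hk2] at hdisc hpow hsqpow
      obtain ⟨e, he⟩ : ∃ e, β = 4 * n * e := ⟨β / (4 * n), by field_simp⟩
      have h4n : (4 * n) ^ k = -1 := by
        rw [mul_pow, hpow n hn, show (4 : F) = 2 ^ 2 by norm_num, hsqpow 2 h2, one_mul]
      have hb := linear_coeff_eq_zero_of_quartic_values hk
        (a := (c ^ 2 - 27 * n ^ 2 - 18 * c * n - 24 * n * e ^ 2) / (8 * n))
        (b := (32 * n * e ^ 3 - 2 * (c ^ 2 - 27 * n ^ 2 - 18 * c * n) * e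
          - (54 * n + 18 * c) * (4 * n * e)) / (8 * n))
        (c := (4 * n * e ^ 4 - 4 * (4 * n * e) * e ^ 3 + (c ^ 2 - 27 * n ^ 2 - 18 * c * n) * e ^ 2
          + (54 * n + 18 * c) * (4 * n * e) * e - 4 * c ^ 3 - 27 * (4 * n * e) ^ 2) / (4 * n)) (by
          intro x
          have hd := hdisc (x - e)
          rw [he] at hd
          have h8 : (8 : F) ≠ 0 := fun h => mul_ne_zero h4 h2 (by linear_combination h)
          have h4n0 : (4 * n) ^ k ≠ 0 := by rw [h4n]; simp
          apply mul_left_cancel₀ h4n0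
          rw [← mul_pow, mul_one, h4n, ← hd]
          congr 1
          field_simp
          ring)
      have h8 : (8 * n : F) ≠ 0 := fun h => mul_ne_zero (mul_ne_zero h4 h2) hn0
        (by linear_combination h)
      rw [div_eq_zero_iff, or_iff_left h8] at hb
      have hprod : 2 * e * (16 * n * e ^ 2 - (c + 9 * n) ^ 2) = 0 := by linear_combination hb
      by_contra hβ
      have he0 : e ≠ 0 := fun h => hβ (by rw [he, h, mul_zero])
      have hsq := (mul_eq_zero.mp hprod).resolve_left (mul_ne_zero h2 he0)
      apply hn
      refine ⟨(c + 9 * n) / (4 * e), ?_⟩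
      field_simp
      linear_combination hsq
    subst hβ
    refine ⟨1, 0, 0, -1 / n, 1, 0, 0, 1, c, -1 / n, ?_, ?_, ?_, ?_, ?_⟩
    · simpa using hn0
    · simp
    · simpa using hn0
    · simp [comb, subst]
    · simp [comb, subst, neg_div, hn0]

lemma hasOddForm_of_lead [Fintype F] (hodd : Odd (Fintype.card F)) {u v w r s t : F}
    (hi : PairInjective ⟨1, u, v, w⟩ (⟨0, r, s, t⟩ : Cubic F))
    (hs : PairSeparable ⟨1, u, v, w⟩ (⟨0, r, s, t⟩ : Cubic F)) :
    HasOddForm ⟨1, u, v, w⟩ (⟨0, r, s, t⟩ : Cubic F) := by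
  have h2 : (2 : F) ≠ 0 := Ring.two_ne_zero fun h => by
    have := FiniteField.even_card_iff_char_two.mp h
    rw [← Nat.not_even_iff_odd, Nat.even_iff] at hodd
    exact hodd this
  by_cases hr : r = 0
  · subst hr
    have hs0 : s = 0 := by
      simpa using hi 1 0 (-t) s (by simp only [form]; ring)
    subst hs0
    have ht : t ≠ 0 := by
      rintro rfl
      exact hi.right_ne_zero rfl
    have hM : 1 * (1 / t) - 0 * 0 ≠ 0 := by simpa using ht
    have hi' := hi.comb hM
    have hs' := hs.comb hM
    apply HasOddForm.of_comb hM
    have e1 : comb 1 0 ⟨1, u, v, w⟩ (⟨0, 0, 0, t⟩ : Cubic F) = ⟨1, u, v, w⟩ := by simp [comb]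
    have e2 : comb 0 (1 / t) ⟨1, u, v, w⟩ (⟨0, 0, 0, t⟩ : Cubic F) = ⟨0, 0, 0, 1⟩ := by
      simp [comb, ht]
    rw [e1, e2] at hi' hs' ⊢
    exact hasOddForm_of_polynomial h2 hi' hs'
  · obtain ⟨l, hl⟩ : ∃ l, s = 2 * r * l := ⟨s / (2 * r), by field_simp⟩
    have hM1 : 1 * 1 - -l * 0 ≠ (0 : F) := by simp
    have hM2 : 1 * (1 / r) - (-(u - 3 * l) / r) * 0 ≠ 0 := by simpa using hr
    have hi' := (hi.subst hM1).comb hM2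
    have hs' := (hs.subst hM1).comb hM2
    apply HasOddForm.of_subst hM1
    apply HasOddForm.of_comb hM2
    generalize hP : comb 1 (-(u - 3 * l) / r) ((⟨1, u, v, w⟩ : Cubic F).subst 1 (-l) 0 1)
        ((⟨0, r, s, t⟩ : Cubic F).subst 1 (-l) 0 1) = P' at *
    generalize hQ : comb 0 (1 / r) ((⟨1, u, v, w⟩ : Cubic F).subst 1 (-l) 0 1)
        ((⟨0, r, s, t⟩ : Cubic F).subst 1 (-l) 0 1) = Q' at *
    have e1 : P' = ⟨1, 0, P'.c, P'.d⟩ := by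
      rw [← hP]
      simp only [comb, subst, mk.injEq, hl, and_true]
      constructor <;> field_simp <;> ring
    have e2 : Q' = ⟨0, 1, 0, - -Q'.d⟩ := by
      rw [← hQ]
      simp only [comb, subst, mk.injEq, hl, neg_neg, and_true]
      refine ⟨?_, ?_, ?_⟩ <;> field_simp <;> ring
    rw [e1, e2] at hi' hs' ⊢
    exact hasOddForm_of_quadratic hodd hi' hs'

/-- Over a finite field of odd order, a pair of binary cubic forms which is injective on the
projective line and separable can be brought to odd form. -/
theorem PairInjective.hasOddForm [Fintype F] (hodd : Odd (Fintype.card F))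
    (hi : PairInjective P Q) (hs : PairSeparable P Q) : HasOddForm P Q := by
  obtain ⟨a, b, c, d, hM, h1, h0⟩ : ∃ a b c d : F, a * d - b * c ≠ 0 ∧
      a * P.a + b * Q.a = 1 ∧ c * P.a + d * Q.a = 0 := by
    by_cases hQ : Q.a = 0
    · have hP : P.a ≠ 0 := by
        intro hP
        simpa using hi 1 0 0 1 (by simp [form, hP, hQ])
      exact ⟨1 / P.a, 0, 0, 1, by simpa using hP, by simp [hP], by simp [hQ]⟩
    · exact ⟨0, 1 / Q.a, 1, -P.a / Q.a, by simpa using hQ, by simp [hQ], by field_simp; ring⟩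
  have hi' := hi.comb hM
  have hs' := hs.comb hM
  apply HasOddForm.of_comb hM
  generalize hP' : Cubic.comb a b P Q = P' at *
  generalize hQ' : Cubic.comb c d P Q = Q' at *
  have e1 : P' = ⟨1, P'.b, P'.c, P'.d⟩ := by rw [← hP']; simp [Cubic.comb, h1]
  have e2 : Q' = ⟨0, Q'.b, Q'.c, Q'.d⟩ := by rw [← hQ']; simp [Cubic.comb, h0]
  rw [e1, e2] at hi' hs' ⊢
  exact hasOddForm_of_lead hodd hi' hs'

end Cubic

/-- The coefficients of a polynomial of degree at most three. -/
def Polynomial.toBinaryCubic {F : Type} [Field F] (f : F[X]) : Cubic F :=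
  ⟨f.coeff 3, f.coeff 2, f.coeff 1, f.coeff 0⟩

lemma Polynomial.eq_of_natDegree_le_three {F : Type} [Field F] {f : F[X]} (hf : f.natDegree ≤ 3) :
    f = C (f.coeff 3) * X ^ 3 + C (f.coeff 2) * X ^ 2 + C (f.coeff 1) * X + C (f.coeff 0) := by
  conv_lhs => rw [f.as_sum_range_C_mul_X_pow' (n := 4) (by omega)]
  simp [Finset.sum_range_succ]
  ring

lemma Polynomial.form_toBinaryCubic_of_ne_zero {F : Type} [Field F] {f : F[X]}
    (hf : f.natDegree ≤ 3) (x : F) {z : F} (hz : z ≠ 0) :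
    f.toBinaryCubic.form x z = z ^ 3 * f.eval (x / z) := by
  conv_rhs => rw [eq_of_natDegree_le_three hf]
  simp [toBinaryCubic, Cubic.form]
  field_simp

lemma Polynomial.form_toBinaryCubic_zero {F : Type} [Field F] (f : F[X]) (x : F) :
    f.toBinaryCubic.form x 0 = x ^ 3 * f.coeff 3 := by
  simp [toBinaryCubic, Cubic.form, mul_comm]

open scoped Classical in
/-- The point `(x : z)` of the projective line. -/
def projPoint {F : Type} [Field F] (x z : F) : Option F := if z = 0 then none else some (x / z)

lemma projPoint_eq_of_mul_eq {F : Type} [Field F] {x z x' z' : F} (h : x ≠ 0 ∨ z ≠ 0)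
    (h' : x' ≠ 0 ∨ z' ≠ 0) (he : x * z' = x' * z) : projPoint x z = projPoint x' z' := by
  unfold projPoint
  by_cases hz : z = 0
  · have hz' : z' = 0 := by
      subst hz
      simpa [h.resolve_right (by simp)] using he
    simp [hz, hz']
  · have hz' : z' ≠ 0 := by
      rintro rfl
      simp [hz] at he
      simp [he] at h'
    simp only [hz, hz', if_false, Option.some.injEq]
    rw [div_eq_div_iff hz hz', he]

lemma mul_eq_of_projPoint_eq {F : Type} [Field F] {x z x' z' : F}
    (he : projPoint x z = projPoint x' z') : x * z' = x' * z := by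
  unfold projPoint at he
  by_cases hz : z = 0 <;> by_cases hz' : z' = 0 <;> simp [hz, hz'] at he ⊢
  rwa [div_eq_div_iff hz hz'] at he

lemma ratEval_projPoint {F : Type} [Field F] {f g : F[X]}
    (hdeg : max f.natDegree g.natDegree = 3) (hfg : IsCoprime f g) {x z : F} (h : x ≠ 0 ∨ z ≠ 0) :
    (f.toBinaryCubic.form x z ≠ 0 ∨ g.toBinaryCubic.form x z ≠ 0) ∧
    ratEval f g (projPoint x z)
      = projPoint (f.toBinaryCubic.form x z) (g.toBinaryCubic.form x z) := by
  have hf : f.natDegree ≤ 3 := hdeg ▸ le_max_left _ _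
  have hg : g.natDegree ≤ 3 := hdeg ▸ le_max_right _ _
  by_cases hz : z = 0
  · subst hz
    have hx : x ≠ 0 := h.resolve_right (by simp)
    have hx3 := pow_ne_zero 3 hx
    rw [form_toBinaryCubic_zero, form_toBinaryCubic_zero]
    have hp : projPoint x 0 = none := by simp [projPoint]
    rw [hp]
    have lead : ∀ {p : F[X]}, p.natDegree = 3 → p.coeff 3 ≠ 0 := fun {p} hp => by
      rw [← hp]
      intro h
      have h0 : p = 0 := leadingCoeff_eq_zero.mp h
      simp [h0] at hp
    rcases lt_trichotomy f.natDegree g.natDegree with hlt | heq | hlt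
    · have hg3 : g.natDegree = 3 := by omega
      have hf0 : f.coeff 3 = 0 := coeff_eq_zero_of_natDegree_lt (by omega)
      refine ⟨Or.inr (mul_ne_zero hx3 (lead hg3)), ?_⟩
      simp [ratEval, projPoint, hf0, hlt, hlt.not_gt, hx, lead hg3]
    · have hg3 : g.natDegree = 3 := by omega
      refine ⟨Or.inr (mul_ne_zero hx3 (lead hg3)), ?_⟩
      simp only [ratEval, projPoint, heq, lt_irrefl, if_false, mul_eq_zero, hx3, lead hg3, or_false,
        leadingCoeff, hg3]
      rw [mul_div_mul_left _ _ hx3]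
    · have hf3 : f.natDegree = 3 := by omega
      have hg0 : g.coeff 3 = 0 := coeff_eq_zero_of_natDegree_lt (by omega)
      refine ⟨Or.inl (mul_ne_zero hx3 (lead hf3)), ?_⟩
      simp [ratEval, projPoint, hg0, hlt]
  · have hz3 := pow_ne_zero 3 hz
    rw [form_toBinaryCubic_of_ne_zero hf x hz, form_toBinaryCubic_of_ne_zero hg x hz]
    have hp : projPoint x z = some (x / z) := by simp [projPoint, hz]
    rw [hp]
    by_cases h0 : g.eval (x / z) = 0
    · refine ⟨Or.inl (mul_ne_zero hz3 ?_), ?_⟩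
      · intro hf0
        obtain ⟨u, v, huv⟩ := hfg
        have := congrArg (eval (x / z)) huv
        simp [h0, hf0] at this
      · simp [ratEval, projPoint, h0]
    · refine ⟨Or.inr (mul_ne_zero hz3 h0), ?_⟩
      simp only [ratEval, projPoint, ne_eq, h0, not_false_eq_true, if_true, mul_eq_zero, hz3,
        or_false, if_false]
      rw [mul_div_mul_left _ _ hz3]

lemma Cubic.pairInjective_of_ratEval {F : Type} [Field F] {f g : F[X]}
    (hdeg : max f.natDegree g.natDegree = 3) (hfg : IsCoprime f g)
    (hinj : Function.Injective (ratEval f g)) :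
    Cubic.PairInjective f.toBinaryCubic g.toBinaryCubic := by
  intro x z x' z' he
  by_cases h : x ≠ 0 ∨ z ≠ 0
  · by_cases h' : x' ≠ 0 ∨ z' ≠ 0
    · obtain ⟨h1, h2⟩ := ratEval_projPoint hdeg hfg h
      obtain ⟨h1', h2'⟩ := ratEval_projPoint hdeg hfg h'
      apply mul_eq_of_projPoint_eq
      apply hinj
      rw [h2, h2']
      exact projPoint_eq_of_mul_eq h1 h1' he
    · push Not at h'
      simp [h']
  · push Not at h
    simp [h]

lemma Cubic.pairSeparable_of_fiberPoly {F : Type} [Field F] {f g : F[X]}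
    (hdeg : max f.natDegree g.natDegree = 3) (hsep : (fiberPoly f g).Separable) :
    Cubic.PairSeparable f.toBinaryCubic g.toBinaryCubic := by
  rintro h3 ⟨h1, h2, h4, h5⟩
  simp only [toBinaryCubic] at h1 h2 h4 h5
  have hd : ∀ {p : F[X]}, p.natDegree ≤ 3 → p.coeff 2 = 0 → p.coeff 1 = 0 → derivative p = 0 := by
    intro p hp hp2 hp1
    rw [eq_of_natDegree_le_three hp, hp2, hp1]
    simp only [derivative_add, derivative_C_mul, derivative_X_pow, derivative_C, h3, map_zero,
      Nat.cast_ofNat]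
    simp
  have hf' := hd (hdeg ▸ le_max_left _ _) h1 h2
  have hg' := hd (hdeg ▸ le_max_right _ _) h4 h5
  have hder : derivative (fiberPoly f g) = 0 := by
    simp [fiberPoly, derivative_map, hf', hg']
  rw [Polynomial.Separable, hder, isCoprime_zero_right] at hsep
  have hcoef : (fiberPoly f g).coeff 3 = 0 := by
    apply coeff_eq_zero_of_natDegree_lt
    rw [natDegree_eq_zero_of_isUnit hsep]; norm_num
  have hpoly : C (f.coeff 3) - C (g.coeff 3) * X = (0 : F[X]) := by
    apply RatFunc.algebraMap_injective F
    simpa [fiberPoly, RatFunc.algebraMap_eq_C, mul_comm RatFunc.X] using hcoef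
  have hf3 : f.coeff 3 = 0 := by simpa using congrArg (fun p => coeff p 0) hpoly
  have hg3 : g.coeff 3 = 0 := by simpa [coeff_C] using congrArg (fun p => coeff p 1) hpoly
  have lead : ∀ {p : F[X]}, p.natDegree = 3 → p.coeff 3 ≠ 0 := fun {p} hp => by
    rw [← hp]
    intro h
    have h0 : p = 0 := leadingCoeff_eq_zero.mp h
    simp [h0] at hp
  rcases max_choice f.natDegree g.natDegree with h | h
  · exact lead (h ▸ hdeg) hf3
  · exact lead (h ▸ hdeg) hg3

/-- Composing with a Möbius transformation on the left. -/
lemma rfComp_mobius {F : Type} [Field F] {a b c d : F} {ψ : RatFunc F}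
    (h : RatFunc.C c * ψ + RatFunc.C d ≠ 0) :
    rfComp ((RatFunc.C a * RatFunc.X + RatFunc.C b) / (RatFunc.C c * RatFunc.X + RatFunc.C d)) ψ
      = (RatFunc.C a * ψ + RatFunc.C b) / (RatFunc.C c * ψ + RatFunc.C d) := by
  set m := (RatFunc.C a * RatFunc.X + RatFunc.C b) / (RatFunc.C c * RatFunc.X + RatFunc.C d)
    with hm
  have hq : (C c * X + C d : F[X]) ≠ 0 := by
    intro h0
    have := congrArg (aeval ψ) h0
    simp [RatFunc.algebraMap_eq_C] at this
    exact h this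
  have hnum := (RatFunc.num_mul_eq_mul_denom_iff (x := m) (p := C a * X + C b) hq).mpr
    (by simp [hm])
  have hdvd : m.denom ∣ C c * X + C d :=
    (RatFunc.isCoprime_num_denom m).symm.dvd_of_dvd_mul_left ⟨_, by rw [hnum, mul_comm]⟩
  have hden : aeval ψ m.denom ≠ 0 := by
    obtain ⟨r, hr⟩ := hdvd
    intro h0
    have := congrArg (aeval ψ) hr
    simp [RatFunc.algebraMap_eq_C, h0] at this
    exact h this
  have hev := congrArg (aeval ψ) hnum
  simp only [map_mul, map_add, aeval_C, aeval_X, RatFunc.algebraMap_eq_C] at hev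
  rw [rfComp, div_eq_div_iff hden h, hev]

lemma Polynomial.aeval_div_of_natDegree_le_three {F : Type} [Field F] {f : F[X]}
    (hf : f.natDegree ≤ 3) {A B : RatFunc F} (hB : B ≠ 0) :
    aeval (A / B) f = (RatFunc.C (f.coeff 3) * A ^ 3 + RatFunc.C (f.coeff 2) * A ^ 2 * B
      + RatFunc.C (f.coeff 1) * A * B ^ 2 + RatFunc.C (f.coeff 0) * B ^ 3) / B ^ 3 := by
  conv_lhs => rw [eq_of_natDegree_le_three hf]
  simp only [map_mul, map_add, map_pow, aeval_C, aeval_X, RatFunc.algebraMap_eq_C]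
  field_simp

lemma Cubic.HasOddForm.exists_rfEquiv {F : Type} [Field F] {φ : RatFunc F}
    (hdeg : max φ.num.natDegree φ.denom.natDegree = 3)
    (h : Cubic.HasOddForm φ.num.toBinaryCubic φ.denom.toBinaryCubic) :
    ∃ a b : F, b ≠ 0 ∧
      RFEquiv φ (algebraMap F[X] (RatFunc F) (X ^ 3 + C a * X) /
        algebraMap F[X] (RatFunc F) (C b * X ^ 2 + 1)) := by
  obtain ⟨a, b, c, d, α, β, γ, δ, e, k, hM, hN, hk, h1, h2⟩ := h
  refine ⟨e, k, hk, _, _, ⟨a, b, c, d, hM, rfl⟩, ⟨α, β, γ, δ, hN, rfl⟩, ?_⟩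
  have hf : φ.num.natDegree ≤ 3 := hdeg ▸ le_max_left _ _
  have hg : φ.denom.natDegree ≤ 3 := hdeg ▸ le_max_right _ _
  generalize hA : RatFunc.C α * RatFunc.X + RatFunc.C β = A
  generalize hB : RatFunc.C γ * RatFunc.X + RatFunc.C δ = B
  have hB0 : B ≠ 0 := by
    have : B = algebraMap F[X] (RatFunc F) (C γ * X + C δ) := by simp [← hB]
    rw [this, Ne, map_eq_zero_iff _ (RatFunc.algebraMap_injective F)]
    intro h
    have hγ : γ = 0 := by simpa [coeff_C] using congrArg (fun p => coeff p 1) h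
    have hδ : δ = 0 := by simpa using congrArg (fun p => coeff p 0) h
    simp [hγ, hδ] at hN
  rw [rfComp.eq_1 φ, aeval_div_of_natDegree_le_three hf hB0, aeval_div_of_natDegree_le_three hg hB0,
    div_div_div_cancel_right₀ (pow_ne_zero 3 hB0)]
  generalize hHf : RatFunc.C (φ.num.coeff 3) * A ^ 3 + RatFunc.C (φ.num.coeff 2) * A ^ 2 * B
      + RatFunc.C (φ.num.coeff 1) * A * B ^ 2 + RatFunc.C (φ.num.coeff 0) * B ^ 3 = Hf
  generalize hHg : RatFunc.C (φ.denom.coeff 3) * A ^ 3 + RatFunc.C (φ.denom.coeff 2) * A ^ 2 * B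
      + RatFunc.C (φ.denom.coeff 1) * A * B ^ 2 + RatFunc.C (φ.denom.coeff 0) * B ^ 3 = Hg
  have hlin : ∀ r s : F, RatFunc.C r * Hf + RatFunc.C s * Hg
      = let S := (comb r s φ.num.toBinaryCubic φ.denom.toBinaryCubic).subst α β γ δ
        RatFunc.C S.a * RatFunc.X ^ 3 + RatFunc.C S.b * RatFunc.X ^ 2
          + RatFunc.C S.c * RatFunc.X + RatFunc.C S.d := by
    intro r s
    rw [← hHf, ← hHg, ← hA, ← hB]
    simp only [subst, comb, toBinaryCubic, map_add, map_mul, map_pow, map_ofNat]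
    ring
  have hnum := hlin a b
  have hden := hlin c d
  rw [h1] at hnum
  rw [h2] at hden
  simp only [map_one, map_zero, zero_mul, one_mul, zero_add, add_zero] at hnum hden
  have hden0 : RatFunc.C k * RatFunc.X ^ 2 + 1 ≠ 0 := by
    have : RatFunc.C k * RatFunc.X ^ 2 + 1 = algebraMap F[X] (RatFunc F) (C k * X ^ 2 + 1) := by
      simp
    rw [this, Ne, map_eq_zero_iff _ (RatFunc.algebraMap_injective F)]
    intro h
    simpa using congrArg (fun p => coeff p 0) h
  have hHg0 : Hg ≠ 0 := by
    intro h0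
    rw [h0, mul_zero, add_zero] at hnum hden
    have hp : C c * (X ^ 3 + C e * X) - C a * (C k * X ^ 2 + 1) = (0 : F[X]) := by
      apply RatFunc.algebraMap_injective F
      simp only [map_sub, map_mul, map_add, map_pow, RatFunc.algebraMap_C, RatFunc.algebraMap_X,
        map_one, map_zero]
      rw [← hnum, ← hden]
      ring
    have ha : a = 0 := by simpa using congrArg (fun p => coeff p 0) hp
    have hc : c = 0 := by
      simpa [coeff_X, coeff_one, mul_add, ha] using congrArg (fun p => coeff p 3) hp
    simp [ha, hc] at hM
  have hcomp : RatFunc.C c * (Hf / Hg) + RatFunc.C d = (RatFunc.C k * RatFunc.X ^ 2 + 1) / Hg := by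
    rw [← hden]; field_simp
  have hcomp' : RatFunc.C a * (Hf / Hg) + RatFunc.C b
      = (RatFunc.X ^ 3 + RatFunc.C e * RatFunc.X) / Hg := by
    rw [← hnum]; field_simp
  rw [rfComp_mobius (by rw [hcomp]; exact div_ne_zero hden0 hHg0), hcomp, hcomp',
    div_div_div_cancel_right₀ hHg0]
  simp

theorem stmt_6 (F : Type) [Field F] [Fintype F] (hodd : Odd (Fintype.card F))
    (φ : RatFunc F) (hdeg : max φ.num.natDegree φ.denom.natDegree = 3)
    (hsep : (fiberPoly φ.num φ.denom).Separable)
    (hperm : Function.Bijective (ratEval φ.num φ.denom)) :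
    ∃ a b : F, b ≠ 0 ∧
      RFEquiv φ (algebraMap F[X] (RatFunc F) (X ^ 3 + C a * X) /
        algebraMap F[X] (RatFunc F) (C b * X ^ 2 + 1)) := by
  have hcop := RatFunc.isCoprime_num_denom φ
  exact ((Cubic.pairInjective_of_ratEval hdeg hcop hperm.injective).hasOddForm hodd
    (Cubic.pairSeparable_of_fiberPoly hdeg hsep)).exists_rfEquiv hdeg

end
end

section
/- Let q be an odd prime power and let φ ∈ F_q(x) be a separable permutation rational function of degree 3. Then for every positive integer n, φ induces a permutation of P¹(F_{q^n}) if and only if n is odd. -/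
open Polynomial

noncomputable section

/-- The binary cubic form `a x³ + b x² y + c x y² + d y³` attached to a cubic. -/
def cubicForm {K : Type*} [Field K] (P : Cubic K) (x y : K) : K :=
  P.a * x ^ 3 + P.b * x ^ 2 * y + P.c * x * y ^ 2 + P.d * y ^ 3

/-- The member `u P + v Q` of the pencil of cubics spanned by `P` and `Q`. -/
def cubicPencil {K : Type*} [Field K] (P Q : Cubic K) (u v : K) : Cubic K :=
  ⟨u * P.a + v * Q.a, u * P.b + v * Q.b, u * P.c + v * Q.c, u * P.d + v * Q.d⟩

/-- The cubic whose binary form is `k (y₀ x - x₀ y)³`. -/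
def cubeCubic {K : Type*} [Field K] (k x₀ y₀ : K) : Cubic K :=
  ⟨k * y₀ ^ 3, -3 * k * y₀ ^ 2 * x₀, 3 * k * y₀ * x₀ ^ 2, -k * x₀ ^ 3⟩

/-- A binary cubic form that is a nonzero multiple of the cube of a linear form. -/
def IsCubeForm {K : Type*} [Field K] (P : Cubic K) : Prop :=
  ∃ k x₀ y₀ : K, k ≠ 0 ∧ (x₀ ≠ 0 ∨ y₀ ≠ 0) ∧ P = cubeCubic k x₀ y₀

/-- The form has at most one zero on the projective line. -/
def AtMostOneZero {K : Type*} [Field K] (P : Cubic K) : Prop :=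
  ∀ x y x' y' : K, (x ≠ 0 ∨ y ≠ 0) → (x' ≠ 0 ∨ y' ≠ 0) →
    cubicForm P x y = 0 → cubicForm P x' y' = 0 → x * y' = x' * y

section Forms

variable {K : Type*} [Field K]

lemma cubicForm_cubicPencil (P Q : Cubic K) (u v x y : K) :
    cubicForm (cubicPencil P Q u v) x y = u * cubicForm P x y + v * cubicForm Q x y := by
  simp only [cubicForm, cubicPencil]; ring

lemma cubicForm_cubeCubic (k x₀ y₀ x y : K) :
    cubicForm (cubeCubic k x₀ y₀) x y = k * (y₀ * x - x₀ * y) ^ 3 := by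
  simp only [cubicForm, cubeCubic]; ring

lemma discr_cubeCubic (k x₀ y₀ : K) : (cubeCubic k x₀ y₀).discr = 0 := by
  simp only [Cubic.discr, cubeCubic]; ring

lemma IsCubeForm.discr_eq_zero {P : Cubic K} (h : IsCubeForm P) : P.discr = 0 := by
  obtain ⟨k, x₀, y₀, -, -, rfl⟩ := h
  exact discr_cubeCubic k x₀ y₀

lemma IsCubeForm.map {L : Type*} [Field L] (i : K →+* L) {P : Cubic K} (h : IsCubeForm P) :
    IsCubeForm (P.map i) := by
  obtain ⟨k, x₀, y₀, hk, h0, rfl⟩ := h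
  refine ⟨i k, i x₀, i y₀, by simpa using hk, by simpa using h0, ?_⟩
  ext <;> simp [Cubic.map, cubeCubic, map_ofNat]

lemma mul_eq_mul_of_proportional {x₀ y₀ x y x' y' : K} (h0 : x₀ ≠ 0 ∨ y₀ ≠ 0)
    (h : y₀ * x = x₀ * y) (h' : y₀ * x' = x₀ * y') : x * y' = x' * y := by
  rcases h0 with h0 | h0
  · apply mul_left_cancel₀ h0; linear_combination x' * h - x * h'
  · apply mul_left_cancel₀ h0; linear_combination y' * h - y * h'

lemma IsCubeForm.atMostOneZero {P : Cubic K} (h : IsCubeForm P) : AtMostOneZero P := by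
  obtain ⟨k, x₀, y₀, hk, h0, rfl⟩ := h
  intro x y x' y' _ _ hx hx'
  rw [cubicForm_cubeCubic] at hx hx'
  have e1 : y₀ * x - x₀ * y = 0 := by simpa [hk] using hx
  have e2 : y₀ * x' - x₀ * y' = 0 := by simpa [hk] using hx'
  exact mul_eq_mul_of_proportional h0 (sub_eq_zero.1 e1) (sub_eq_zero.1 e2)

/-- A quadratic form vanishing at `(x₀, y₀)` is divisible by the corresponding linear form. -/
lemma exists_quadratic_factor {α β γ x₀ y₀ : K} (h0 : x₀ ≠ 0 ∨ y₀ ≠ 0)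
    (h : α * x₀ ^ 2 + β * x₀ * y₀ + γ * y₀ ^ 2 = 0) :
    ∃ δ ε : K, α = y₀ * δ ∧ β = y₀ * ε - x₀ * δ ∧ γ = -(x₀ * ε) := by
  by_cases hy : y₀ = 0
  · have hx : x₀ ≠ 0 := by simpa [hy] using h0
    subst hy
    refine ⟨-β / x₀, -γ / x₀, ?_, ?_, ?_⟩
    · have : α = 0 := by simpa [hx] using h
      simp [this]
    · field_simp; ring
    · field_simp
  · refine ⟨α / y₀, (β + x₀ * (α / y₀)) / y₀, ?_, ?_, ?_⟩
    · field_simp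
    · field_simp; ring
    · field_simp; linear_combination h

/-- A cubic form vanishing at `(x₀, y₀)` is divisible by the corresponding linear form. -/
lemma exists_cubic_factor {P : Cubic K} {x₀ y₀ : K} (h0 : x₀ ≠ 0 ∨ y₀ ≠ 0)
    (h : cubicForm P x₀ y₀ = 0) :
    ∃ α β γ : K, P = ⟨y₀ * α, y₀ * β - x₀ * α, y₀ * γ - x₀ * β, -(x₀ * γ)⟩ := by
  obtain ⟨a, b, c, d⟩ := P
  simp only [cubicForm] at h
  by_cases hy : y₀ = 0
  · have hx : x₀ ≠ 0 := by simpa [hy] using h0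
    subst hy
    refine ⟨-b / x₀, -c / x₀, -d / x₀, ?_⟩
    have : a = 0 := by simpa [hx] using h
    ext <;> simp [this] <;> field_simp
  · refine ⟨a / y₀, (b + x₀ * (a / y₀)) / y₀,
      (c + x₀ * ((b + x₀ * (a / y₀)) / y₀)) / y₀, ?_⟩
    ext <;> simp only
    · field_simp
    · field_simp; ring
    · field_simp; ring
    · field_simp; linear_combination h

lemma discr_linear_mul_quadratic (x₀ y₀ α β γ : K) :
    (⟨y₀ * α, y₀ * β - x₀ * α, y₀ * γ - x₀ * β, -(x₀ * γ)⟩ : Cubic K).discr =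
      (β ^ 2 - 4 * α * γ) * (α * x₀ ^ 2 + β * x₀ * y₀ + γ * y₀ ^ 2) ^ 2 := by
  simp only [Cubic.discr]; ring

lemma cubicForm_linear_mul_quadratic (x₀ y₀ α β γ x y : K) :
    cubicForm ⟨y₀ * α, y₀ * β - x₀ * α, y₀ * γ - x₀ * β, -(x₀ * γ)⟩ x y =
      (y₀ * x - x₀ * y) * (α * x ^ 2 + β * x * y + γ * y ^ 2) := by
  simp only [cubicForm]; ring

/-- A cubic form with square discriminant and exactly one zero is a cube. -/
lemma isCubeForm_of_isSquare_discr (h2 : (2 : K) ≠ 0) {P : Cubic K} {x₀ y₀ : K}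
    (h0 : x₀ ≠ 0 ∨ y₀ ≠ 0) (hroot : cubicForm P x₀ y₀ = 0) (huniq : AtMostOneZero P)
    (hsq : IsSquare P.discr) : IsCubeForm P := by
  obtain ⟨α, β, γ, rfl⟩ := exists_cubic_factor h0 hroot
  have key : ∀ x y, (x ≠ 0 ∨ y ≠ 0) → α * x ^ 2 + β * x * y + γ * y ^ 2 = 0 →
      x * y₀ = x₀ * y := fun x y hxy h =>
    huniq x y x₀ y₀ hxy h0 (by rw [cubicForm_linear_mul_quadratic, h, mul_zero]) hroot
  rw [discr_linear_mul_quadratic] at hsq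
  have hR : α * x₀ ^ 2 + β * x₀ * y₀ + γ * y₀ ^ 2 = 0 := by
    by_contra hR
    obtain ⟨r, hr⟩ := hsq
    have hs : β ^ 2 - 4 * α * γ = (r / (α * x₀ ^ 2 + β * x₀ * y₀ + γ * y₀ ^ 2)) ^ 2 := by
      rw [div_pow, eq_div_iff (pow_ne_zero 2 hR), hr, sq]
    set s := r / (α * x₀ ^ 2 + β * x₀ * y₀ + γ * y₀ ^ 2)
    obtain ⟨x, y, hxy, hz⟩ : ∃ x y : K, (x ≠ 0 ∨ y ≠ 0) ∧
        α * x ^ 2 + β * x * y + γ * y ^ 2 = 0 := by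
      by_cases hα : α = 0
      · exact ⟨1, 0, by simp, by simp [hα]⟩
      · exact ⟨-β + s, 2 * α, Or.inr (mul_ne_zero h2 hα), by linear_combination -α * hs⟩
    have hp := key x y hxy hz
    apply hR
    rcases hxy with hx | hy
    · have : x ^ 2 ≠ 0 := pow_ne_zero 2 hx
      apply (mul_eq_zero.1 (_ : x ^ 2 * _ = 0)).resolve_left this
      linear_combination x₀ ^ 2 * hz + (β * x₀ * x + γ * (x * y₀ + x₀ * y)) * hp
    · have : y ^ 2 ≠ 0 := pow_ne_zero 2 hy
      apply (mul_eq_zero.1 (_ : y ^ 2 * _ = 0)).resolve_left this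
      linear_combination y₀ ^ 2 * hz - (α * (x * y₀ + x₀ * y) + β * y * y₀) * hp
  obtain ⟨δ, ε, hα, hβ, hγ⟩ := exists_quadratic_factor h0 hR
  have hne : δ ≠ 0 ∨ ε ≠ 0 := by
    by_contra! hc
    have h1 := key 1 0 (by simp) (by rw [hα, hc.1]; ring)
    have h3 := key 0 1 (by simp) (by rw [hγ, hc.2]; ring)
    simp at h1 h3
    exact h0.elim (fun h => h h3.symm) (fun h => h h1)
  have hp := key (-ε) δ (by simpa [or_comm] using hne) (by rw [hα, hβ, hγ]; ring)
  obtain ⟨k, hδ, hε⟩ : ∃ k, δ = k * y₀ ∧ ε = -(k * x₀) := by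
    rcases h0 with h | h
    · exact ⟨-ε / x₀, by field_simp; linear_combination -hp, by field_simp⟩
    · exact ⟨δ / y₀, by field_simp, by field_simp; linear_combination -hp⟩
  refine ⟨k, x₀, y₀, ?_, h0, ?_⟩
  · rintro rfl
    simp_all
  · ext <;> simp only [cubeCubic, hα, hβ, hγ, hδ, hε] <;> ring

/-- A cubic form with two distinct zeros has square discriminant. -/
lemma atMostOneZero_of_not_isSquare_discr {P : Cubic K} (h : ¬ IsSquare P.discr) :
    AtMostOneZero P := by
  intro x y x' y' h0 h0' hz hz'
  by_contra hne
  obtain ⟨α, β, γ, rfl⟩ := exists_cubic_factor h0 hz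
  rw [cubicForm_linear_mul_quadratic] at hz'
  have hq := (mul_eq_zero.1 hz').resolve_left (fun e => hne (by linear_combination -e))
  obtain ⟨δ, ε, hα, hβ, hγ⟩ := exists_quadratic_factor h0' hq
  apply h
  rw [discr_linear_mul_quadratic]
  refine ⟨(y' * ε + x' * δ) * (α * x ^ 2 + β * x * y + γ * y ^ 2), ?_⟩
  have : β ^ 2 - 4 * α * γ = (y' * ε + x' * δ) ^ 2 := by rw [hα, hβ, hγ]; ring
  rw [this]; ring

lemma discr_cubicPencil_cubeCubic (k x₀ y₀ k' x₁ y₁ s t : K) :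
    (cubicPencil (cubeCubic k x₀ y₀) (cubeCubic k' x₁ y₁) s t).discr =
      -27 * k ^ 2 * k' ^ 2 * (x₀ * y₁ - x₁ * y₀) ^ 6 * (s * t) ^ 2 := by
  simp only [cubicPencil, cubeCubic, Cubic.discr]; ring

/-- The mixed coefficient of the discriminant, of degree 3 in `P` and 1 in `Q`. -/
def discrPolar (P Q : Cubic K) : K :=
  (-4 * P.c ^ 3 - 54 * P.a * P.d ^ 2 + 18 * P.b * P.c * P.d) * Q.a +
  (2 * P.b * P.c ^ 2 - 12 * P.b ^ 2 * P.d + 18 * P.a * P.c * P.d) * Q.b +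
  (2 * P.b ^ 2 * P.c - 12 * P.a * P.c ^ 2 + 18 * P.a * P.b * P.d) * Q.c +
  (-4 * P.b ^ 3 - 54 * P.a ^ 2 * P.d + 18 * P.a * P.b * P.c) * Q.d

/-- The discriminant on a pencil is a binary quartic form. -/
lemma discr_cubicPencil (P Q : Cubic K) (u v : K) :
    (cubicPencil P Q u v).discr = P.discr * u ^ 4 + discrPolar P Q * u ^ 3 * v +
      ((cubicPencil P Q 1 1).discr - P.discr - Q.discr - discrPolar P Q - discrPolar Q P)
        * u ^ 2 * v ^ 2 + discrPolar Q P * u * v ^ 3 + Q.discr * v ^ 4 := by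
  simp only [cubicPencil, discrPolar, Cubic.discr]; ring

lemma discrPolar_cubeCubic (k x₀ y₀ : K) (Q : Cubic K) :
    discrPolar (cubeCubic k x₀ y₀) Q = 0 := by
  simp only [discrPolar, cubeCubic]; ring

/-- Change of basis in a pencil. -/
lemma cubicPencil_cubicPencil (P Q : Cubic K) (u₀ v₀ u₁ v₁ s t : K) :
    cubicPencil (cubicPencil P Q u₀ v₀) (cubicPencil P Q u₁ v₁) s t =
      cubicPencil P Q (s * u₀ + t * u₁) (s * v₀ + t * v₁) := by
  ext <;> simp only [cubicPencil] <;> ring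

lemma map_cubicPencil {L : Type*} [Field L] (i : K →+* L) (P Q : Cubic K) (u v : K) :
    (cubicPencil P Q u v).map i = cubicPencil (P.map i) (Q.map i) (i u) (i v) := by
  ext <;> simp [Cubic.map, cubicPencil]

lemma map_discr {L : Type*} [Field L] (i : K →+* L) (P : Cubic K) :
    (P.map i).discr = i P.discr := by
  simp [Cubic.map, Cubic.discr, map_ofNat]

lemma map_discrPolar {L : Type*} [Field L] (i : K →+* L) (P Q : Cubic K) :
    discrPolar (P.map i) (Q.map i) = i (discrPolar P Q) := by
  simp [Cubic.map, discrPolar, map_ofNat]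

end Forms

section Quartic

variable {F : Type*} [Field F]

/-- If `(K² / N)' = 0` for a quartic `N` without zeros and a quadratic `K`, then `N` is a
scalar multiple of a square. -/
lemma quartic_eq_square_of_derivative_relation (h2 : (2 : F) ≠ 0) {a b c d e k₂ k₁ k₀ : F}
    (hk : k₂ ≠ 0) (hroot : ∀ t, a * t ^ 4 + b * t ^ 3 + c * t ^ 2 + d * t + e ≠ 0)
    (e4 : 2 * a * k₁ = b * k₂) (e3 : 4 * a * k₀ + b * k₁ = 2 * c * k₂)
    (e2 : 3 * (b * k₀) = 3 * (d * k₂)) (e1 : 2 * c * k₀ - d * k₁ = 4 * e * k₂)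
    (e0 : d * k₀ = 2 * e * k₁) :
    8 * a ^ 2 * d = b * (4 * a * c - b ^ 2) ∧ 64 * a ^ 3 * e = (4 * a * c - b ^ 2) ^ 2 := by
  obtain ⟨r, rfl⟩ : ∃ r, k₁ = k₂ * r := ⟨k₁ / k₂, by field_simp⟩
  obtain ⟨s, rfl⟩ : ∃ s, k₀ = k₂ * s := ⟨k₀ / k₂, by field_simp⟩
  have hb : b = 2 * a * r := by apply mul_left_cancel₀ hk; linear_combination -e4
  subst hb
  have hc : c = a * (r ^ 2 + 2 * s) := by
    apply mul_left_cancel₀ (mul_ne_zero h2 hk); linear_combination -e3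
  subst hc
  have h0 : d * s = 2 * e * r := by apply mul_left_cancel₀ hk; linear_combination e0
  have h1 : 4 * e = 2 * (a * (r ^ 2 + 2 * s)) * s - d * r := by
    apply mul_left_cancel₀ hk; linear_combination -e1
  have h3 : 3 * (d - 2 * a * r * s) = 0 := by
    apply mul_left_cancel₀ hk; linear_combination -e2
  have hd : d = 2 * a * r * s := by
    by_cases h3' : (3 : F) = 0
    · have h4 : (d - 2 * a * r * s) * (r ^ 2 + 2 * s) = 0 := by
        linear_combination 2 * h0 + r * h1
      rcases mul_eq_zero.1 h4 with h | h
      · exact sub_eq_zero.1 h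
      · exfalso
        apply hroot r
        linear_combination h1 + (a * r ^ 4 - e) * h3' + (a * r ^ 2 + 2 * a * s) * h
    · exact sub_eq_zero.1 ((mul_eq_zero.1 h3).resolve_left h3')
  subst hd
  constructor
  · ring
  · linear_combination 16 * a ^ 3 * h1

lemma coeff_eq_zero_of_quartic_eq_zero {a b c d e : F}
    (h : C a * X ^ 4 + C b * X ^ 3 + C c * X ^ 2 + C d * X + C e = 0) :
    a = 0 ∧ b = 0 ∧ c = 0 ∧ d = 0 ∧ e = 0 := by
  have hcoeff : ∀ n, (C a * X ^ 4 + C b * X ^ 3 + C c * X ^ 2 + C d * X + C e).coeff n = 0 :=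
    fun n => by rw [h, coeff_zero]
  exact ⟨by simpa [coeff_X, coeff_C] using hcoeff 4, by simpa [coeff_X, coeff_C] using hcoeff 3,
    by simpa [coeff_X, coeff_C] using hcoeff 2, by simpa [coeff_X, coeff_C] using hcoeff 1,
    by simpa [coeff_X, coeff_C] using hcoeff 0⟩

lemma zmod_three_quartic : ∀ b c d e : ZMod 3, e = 1 → 1 + b + c + d + e = 1 →
    1 - b + c - d + e = 1 →
    8 * d = b * (4 * c - b ^ 2) ∧ 64 * e = (4 * c - b ^ 2) ^ 2 := by
  decide

set_option synthInstance.maxHeartbeats 400000 in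
set_option synthInstance.maxSize 2000 in
lemma zmod_five_quartic : ∀ a b c d e : ZMod 5, a ^ 2 = 1 → e ^ 2 = 1 →
    (a + b + c + d + e) ^ 2 = 1 → (a - b + c - d + e) ^ 2 = 1 →
    (a * 2 ^ 4 + b * 2 ^ 3 + c * 2 ^ 2 + d * 2 + e) ^ 2 = 1 →
    (a * 3 ^ 4 + b * 3 ^ 3 + c * 3 ^ 2 + d * 3 + e) ^ 2 = 1 →
    8 * a ^ 2 * d = b * (4 * a * c - b ^ 2) ∧ 64 * a ^ 3 * e = (4 * a * c - b ^ 2) ^ 2 := by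
  decide +kernel

variable [Fintype F]

lemma two_ne_zero_of_odd_card (hodd : Odd (Fintype.card F)) : (2 : F) ≠ 0 := by
  intro h
  obtain ⟨k, hk⟩ := hodd
  have := Nat.cast_card_eq_zero F
  rw [hk] at this
  push_cast at this
  rw [h] at this
  simp at this

lemma ringChar_ne_two_of_odd_card (hodd : Odd (Fintype.card F)) : ringChar F ≠ 2 := by
  intro h
  apply two_ne_zero_of_odd_card hodd
  exact_mod_cast (ringChar.spec F 2).2 h.dvd

/-- Stepanov's method in degree four: the logarithmic derivative relation satisfied by a
quartic all of whose values are nonzero squares. -/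
lemma quartic_derivative_relation (hodd : Odd (Fintype.card F)) (hq : 7 ≤ Fintype.card F)
    {N : F[X]} (hN : N.natDegree = 4)
    (hsq : ∀ t, N.eval t ^ (Fintype.card F / 2) = 1) :
    ∃ K : F[X], K.natDegree = 2 ∧ derivative N * K = 2 * N * derivative K := by
  set q := Fintype.card F with hqdef
  set m := q / 2 with hm
  have hqm : q = 2 * m + 1 := by obtain ⟨k, hk⟩ := hodd; omega
  have h2 : (2 : F) ≠ 0 := two_ne_zero_of_odd_card hodd
  have hN0 : N ≠ 0 := by rintro rfl; simp at hN
  set T : F[X] := X ^ q - X with hT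
  have hTdeg : T.natDegree = q := FiniteField.X_pow_card_sub_X_natDegree_eq F Fintype.one_lt_card
  have hT0 : T ≠ 0 := FiniteField.X_pow_card_sub_X_ne_zero F Fintype.one_lt_card
  have hT' : derivative T = -1 := by
    simp [hT, derivative_X_pow, hqdef, Nat.cast_card_eq_zero F]
  obtain ⟨h, hh⟩ : T ∣ N ^ m - 1 := by
    have : T = ∏ t : F, (X - C t) := by
      have hmon : T.Monic := by
        have : T = X ^ (q - 1 + 1) - X := by rw [hT]; congr 2; omega
        rw [this]
        exact monic_X_pow_sub (by rw [degree_X]; exact_mod_cast (by omega : 1 < q - 1 + 1))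
      have hr : T.roots = Finset.univ.val := FiniteField.roots_X_pow_card_sub_X F
      have := prod_multiset_X_sub_C_of_monic_of_roots_card_eq hmon
        (by rw [hr, hTdeg]; rfl)
      rw [← this, hr]; rfl
    rw [this]
    apply Finset.prod_dvd_of_coprime
    · intro x _ y _ hxy
      exact (pairwise_coprime_X_sub_C Function.injective_id hxy)
    · intro t _
      rw [dvd_iff_isRoot]
      simp [hsq t]
  have hpow : N ^ m = 1 + T * h := by rw [← hh]; ring
  have hm0 : m ≠ 0 := by omega
  have hpdeg : (N ^ m - 1).natDegree = 4 * m := by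
    rw [natDegree_sub_eq_left_of_natDegree_lt] <;> rw [natDegree_pow, hN]
    · ring
    · simp; omega
  have hh0 : h ≠ 0 := by
    rintro rfl
    rw [hh] at hpdeg; simp at hpdeg; omega
  have hhdeg : h.natDegree + q = 4 * m := by
    rw [hh, natDegree_mul hT0 hh0, hTdeg] at hpdeg; omega
  have hmF : (2 : F[X]) * (m : F[X]) = -1 := by
    have h1 : ((2 * m + 1 : ℕ) : F[X]) = 0 := by
      rw [← hqm, hqdef, ← C_eq_natCast, Nat.cast_card_eq_zero F, C_0]
    push_cast at h1
    linear_combination h1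
  have hder : (m : F[X]) * N ^ (m - 1) * derivative N = -h + T * derivative h := by
    have := congrArg derivative hpow
    rw [derivative_pow, derivative_add, derivative_mul, hT', derivative_one, C_eq_natCast] at this
    rw [this]; ring
  have hNm : N ^ m = N ^ (m - 1) * N := by rw [← pow_succ]; congr 1; omega
  set K := 2 * N * derivative h + derivative N * h with hK
  have E1 : 2 * N * h = derivative N + T * K := by
    have : 2 * N * ((m : F[X]) * N ^ (m - 1) * derivative N) =
      2 * N * (-h + T * derivative h) := by rw [hder]
    rw [hK]
    linear_combination this - N * N ^ (m - 1) * derivative N * hmF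
      - derivative N * hNm + derivative N * hpow
  have hN'deg : (derivative N).natDegree ≤ 3 := (natDegree_derivative_le N).trans (by omega)
  have h2' : (2 : F[X]) = C 2 := (map_ofNat C 2).symm
  have h2N : (2 * N * h).natDegree = q + 2 := by
    rw [mul_assoc, h2', natDegree_C_mul h2, natDegree_mul hN0 hh0, hN]; omega
  have hTK : (T * K).natDegree = q + 2 := by
    have : T * K = 2 * N * h - derivative N := by rw [E1]; ring
    rw [this, natDegree_sub_eq_left_of_natDegree_lt (by omega), h2N]
  have hK0 : K ≠ 0 := by rintro h; rw [h] at hTK; simp at hTK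
  have hKdeg : K.natDegree = 2 := by
    rw [natDegree_mul hT0 hK0, hTdeg] at hTK; omega
  have E2 : T * (derivative N * K - 2 * N * derivative K) =
      2 * N * derivative (derivative N) - derivative N ^ 2 - 4 * K * N := by
    have := congrArg derivative E1
    rw [derivative_add, derivative_mul, derivative_mul, derivative_mul, hT', h2',
      derivative_C] at this
    rw [← h2'] at this
    linear_combination (-derivative N) * E1 + 2 * N * this + 2 * N * hK
  have hdeg6 : (2 * N * derivative (derivative N) - derivative N ^ 2 - 4 * K * N).natDegree
      ≤ 6 := by
    have h4' : (4 : F[X]) = C 4 := (map_ofNat C 4).symm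
    have hN'' : (derivative (derivative N)).natDegree ≤ 2 :=
      (natDegree_derivative_le _).trans (by omega)
    refine (natDegree_sub_le _ _).trans (max_le ((natDegree_sub_le _ _).trans (max_le ?_ ?_)) ?_)
    · rw [mul_assoc, h2']
      refine (natDegree_C_mul_le _ _).trans (natDegree_mul_le.trans (by omega))
    · refine natDegree_pow_le.trans (by omega)
    · rw [mul_assoc, h4']
      refine (natDegree_C_mul_le _ _).trans (natDegree_mul_le.trans (by omega))
  have hJ : derivative N * K - 2 * N * derivative K = 0 := by
    by_contra hJ
    rw [← E2, natDegree_mul hT0 hJ, hTdeg] at hdeg6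
    omega
  exact ⟨K, hKdeg, sub_eq_zero.1 hJ⟩

/-- A quartic over a finite field of odd order whose values on the projective line are all
nonzero squares is a scalar multiple of the square of a quadratic polynomial. -/
lemma quartic_eq_square_of_isSquare_values (hodd : Odd (Fintype.card F)) {a b c d e : F}
    (ha : a ≠ 0) (hasq : IsSquare a)
    (hsq : ∀ t, a * t ^ 4 + b * t ^ 3 + c * t ^ 2 + d * t + e ≠ 0 ∧
      IsSquare (a * t ^ 4 + b * t ^ 3 + c * t ^ 2 + d * t + e)) :
    8 * a ^ 2 * d = b * (4 * a * c - b ^ 2) ∧ 64 * a ^ 3 * e = (4 * a * c - b ^ 2) ^ 2 := by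
  have hchar := ringChar_ne_two_of_odd_card hodd
  have h2 : (2 : F) ≠ 0 := two_ne_zero_of_odd_card hodd
  have hapow := (FiniteField.isSquare_iff hchar ha).1 hasq
  have hpow := fun t => (FiniteField.isSquare_iff hchar (hsq t).1).1 (hsq t).2
  have h1 : 1 < Fintype.card F := Fintype.one_lt_card
  obtain h3 | h5 | h7 : Fintype.card F = 3 ∨ Fintype.card F = 5 ∨ 7 ≤ Fintype.card F := by
    obtain ⟨k, hk⟩ := hodd; omega
  · rw [h3] at hapow hpow
    let σ := ZMod.ringEquivOfPrime F Nat.prime_three h3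
    obtain ⟨b, rfl⟩ := σ.surjective b
    obtain ⟨c, rfl⟩ := σ.surjective c
    obtain ⟨d, rfl⟩ := σ.surjective d
    obtain ⟨e, rfl⟩ := σ.surjective e
    norm_num at hapow hpow
    subst hapow
    have := zmod_three_quartic b c d e
      (σ.injective (by simpa using hpow 0))
      (σ.injective (by simpa using hpow 1))
      (σ.injective (by
        simpa [Odd.neg_pow (by decide : Odd 3),
        Even.neg_pow (by decide : Even 4), ← sub_eq_add_neg] using hpow (-1)))
    constructor
    · simpa [map_ofNat] using congrArg σ this.1
    · simpa [map_ofNat] using congrArg σ this.2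
  · rw [h5] at hapow hpow
    let σ := ZMod.ringEquivOfPrime F Nat.prime_five h5
    obtain ⟨a, rfl⟩ := σ.surjective a
    obtain ⟨b, rfl⟩ := σ.surjective b
    obtain ⟨c, rfl⟩ := σ.surjective c
    obtain ⟨d, rfl⟩ := σ.surjective d
    obtain ⟨e, rfl⟩ := σ.surjective e
    norm_num only at hapow hpow
    have := zmod_five_quartic a b c d e
      (σ.injective (by rw [map_pow, hapow, map_one]))
      (σ.injective (by simpa using hpow 0))
      (σ.injective (by simpa using hpow 1))
      (σ.injective (by
        simpa [Odd.neg_pow (by decide : Odd 3),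
        Even.neg_pow (by decide : Even 4), ← sub_eq_add_neg] using hpow (-1)))
      (σ.injective (by simpa [map_ofNat] using hpow 2))
      (σ.injective (by simpa [map_ofNat] using hpow 3))
    constructor
    · simpa [map_ofNat] using congrArg σ this.1
    · simpa [map_ofNat] using congrArg σ this.2
  · set N : F[X] := C a * X ^ 4 + C b * X ^ 3 + C c * X ^ 2 + C d * X + C e with hN
    have hdeg : N.natDegree = 4 := by rw [hN]; compute_degree!
    obtain ⟨K, hK, hrel⟩ := quartic_derivative_relation hodd h7 hdeg
      (fun t => by simpa [hN] using hpow t)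
    have hKeq : K = C (K.coeff 2) * X ^ 2 + C (K.coeff 1) * X + C (K.coeff 0) :=
      eq_quadratic_of_degree_le_two (natDegree_le_iff_degree_le.1 hK.le)
    have hk : K.coeff 2 ≠ 0 := by
      rw [← hK]; exact leadingCoeff_ne_zero.2 (by rintro rfl; simp at hK)
    generalize K.coeff 2 = k₂ at *
    generalize K.coeff 1 = k₁ at *
    generalize K.coeff 0 = k₀ at *
    have hN' : derivative N = C (4 * a) * X ^ 3 + C (3 * b) * X ^ 2 + C (2 * c) * X + C d := by
      rw [hN]; simp; simp only [C_ofNat]; ring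
    have hK' : derivative K = C (2 * k₂) * X + C k₁ := by
      rw [hKeq]; simp; simp only [C_ofNat]; ring
    rw [hN', hK', hKeq, hN] at hrel
    have hz : C (2 * a * k₁ - b * k₂) * X ^ 4 + C (4 * a * k₀ + b * k₁ - 2 * c * k₂) * X ^ 3
        + C (3 * (b * k₀) - 3 * (d * k₂)) * X ^ 2 + C (2 * c * k₀ - d * k₁ - 4 * e * k₂) * X
        + C (d * k₀ - 2 * e * k₁) = (0 : F[X]) := by
      simp only [C_add, C_sub, C_mul, C_ofNat] at hrel ⊢
      linear_combination hrel
    obtain ⟨e4, e3, e2, e1, e0⟩ := coeff_eq_zero_of_quartic_eq_zero hz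
    exact quartic_eq_square_of_derivative_relation h2 hk (fun t => (hsq t).1) (sub_eq_zero.1 e4)
      (sub_eq_zero.1 e3) (sub_eq_zero.1 e2) (sub_eq_zero.1 e1) (sub_eq_zero.1 e0)

end Quartic

section Pencil

universe w

/-- The discriminant of the pencil spanned by `P` and `Q` is, over every extension, a constant
times the square of a fixed binary quadratic form. -/
def DiscrIsConstMulSq {F : Type w} [Field F] (P Q : Cubic F) (c p q r : F) : Prop :=
  ∀ (K : Type w) [Field K] [Algebra F K] (u v : K),
    (cubicPencil (P.map (algebraMap F K)) (Q.map (algebraMap F K)) u v).discr =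
      algebraMap F K c * (algebraMap F K p * u ^ 2 + algebraMap F K q * u * v +
        algebraMap F K r * v ^ 2) ^ 2

variable {F : Type w} [Field F]

lemma discrIsConstMulSq_of_coeff {P Q : Cubic F} {c p q r : F}
    (h4 : P.discr = c * p ^ 2) (h3 : discrPolar P Q = 2 * c * p * q)
    (h2 : (cubicPencil P Q 1 1).discr - P.discr - Q.discr - discrPolar P Q - discrPolar Q P
      = c * (q ^ 2 + 2 * p * r))
    (h1 : discrPolar Q P = 2 * c * q * r) (h0 : Q.discr = c * r ^ 2) :
    DiscrIsConstMulSq P Q c p q r := by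
  intro K _ _ u v
  rw [discr_cubicPencil]
  have h11 : cubicPencil (P.map (algebraMap F K)) (Q.map (algebraMap F K)) 1 1 =
      (cubicPencil P Q 1 1).map (algebraMap F K) := by simp [map_cubicPencil]
  rw [h11]
  simp only [map_discr, map_discrPolar, ← map_sub]
  rw [h2, h4, h3, h1, h0]
  simp only [map_mul, map_add, map_pow, map_ofNat]
  ring

lemma DiscrIsConstMulSq.of_basis {P Q : Cubic F} {u₀ v₀ u₁ v₁ c p q r : F}
    (hδ : u₀ * v₁ - u₁ * v₀ ≠ 0)
    (h : DiscrIsConstMulSq (cubicPencil P Q u₀ v₀) (cubicPencil P Q u₁ v₁) c p q r) :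
    DiscrIsConstMulSq P Q (c / (u₀ * v₁ - u₁ * v₀) ^ 4)
      (p * v₁ ^ 2 - q * v₁ * v₀ + r * v₀ ^ 2)
      (-2 * p * u₁ * v₁ + q * (u₀ * v₁ + u₁ * v₀) - 2 * r * u₀ * v₀)
      (p * u₁ ^ 2 - q * u₁ * u₀ + r * u₀ ^ 2) := by
  intro K _ _ u v
  set i := algebraMap F K
  have hδ' : i u₀ * i v₁ - i u₁ * i v₀ ≠ 0 := by
    rw [← map_mul, ← map_mul, ← map_sub]; exact (map_ne_zero i).2 hδ
  have := h K ((u * i v₁ - v * i u₁) / (i u₀ * i v₁ - i u₁ * i v₀))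
    ((i u₀ * v - i v₀ * u) / (i u₀ * i v₁ - i u₁ * i v₀))
  rw [map_cubicPencil, map_cubicPencil, cubicPencil_cubicPencil] at this
  have hu : (u * i v₁ - v * i u₁) / (i u₀ * i v₁ - i u₁ * i v₀) * i u₀ +
      (i u₀ * v - i v₀ * u) / (i u₀ * i v₁ - i u₁ * i v₀) * i u₁ = u := by
    rw [div_mul_eq_mul_div, div_mul_eq_mul_div, ← add_div, div_eq_iff hδ']; ring
  have hv : (u * i v₁ - v * i u₁) / (i u₀ * i v₁ - i u₁ * i v₀) * i v₀ +
      (i u₀ * v - i v₀ * u) / (i u₀ * i v₁ - i u₁ * i v₀) * i v₁ = v := by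
    rw [div_mul_eq_mul_div, div_mul_eq_mul_div, ← add_div, div_eq_iff hδ']; ring
  rw [hu, hv] at this
  rw [this]
  simp only [map_div₀, map_mul, map_add, map_sub, map_pow, map_ofNat, map_neg]
  field_simp
  ring

lemma exists_quadraticForm_ne_zero {K : Type*} [Field K] {p q r : K}
    (h : p ≠ 0 ∨ q ≠ 0 ∨ r ≠ 0) :
    ∃ u v : K, (u ≠ 0 ∨ v ≠ 0) ∧ p * u ^ 2 + q * u * v + r * v ^ 2 ≠ 0 := by
  by_contra! hc
  have hp : p = 0 := by simpa using hc 1 0 (by simp)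
  have hr : r = 0 := by simpa using hc 0 1 (by simp)
  have hq : q = 0 := by simpa [hp, hr] using hc 1 1 (by simp)
  simp [hp, hq, hr] at h

/-- A binary quadratic form over `F` with a zero over an extension in which no nonsquare of `F`
becomes a square has that zero over `F`. -/
lemma exists_zero_of_zero_extension (h2 : (2 : F) ≠ 0) {E : Type*} [Field E] [Algebra F E]
    (hE : ∀ a : F, IsSquare (algebraMap F E a) → IsSquare a) {p q r : F}
    (hpqr : p ≠ 0 ∨ q ≠ 0 ∨ r ≠ 0) {u v : E} (huv : u ≠ 0 ∨ v ≠ 0)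
    (h : algebraMap F E p * u ^ 2 + algebraMap F E q * u * v + algebraMap F E r * v ^ 2 = 0) :
    ∃ (u₀ v₀ : F) (t : E), (u₀ ≠ 0 ∨ v₀ ≠ 0) ∧ t ≠ 0 ∧ u = t * algebraMap F E u₀ ∧
      v = t * algebraMap F E v₀ ∧ p * u₀ ^ 2 + q * u₀ * v₀ + r * v₀ ^ 2 = 0 := by
  set i := algebraMap F E
  by_cases hv : v = 0
  · have hu : u ≠ 0 := by simpa [hv] using huv
    have hp : p = 0 := by simpa [hv, hu] using h
    exact ⟨1, 0, u, by simp, hu, by simp, by simp [hv], by simp [hp]⟩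
  by_cases hp : p = 0
  · subst hp
    have h' : i q * u + i r * v = 0 := by
      apply mul_left_cancel₀ hv
      rw [map_zero] at h
      linear_combination h
    have hq : q ≠ 0 := by
      rintro rfl
      have : r ≠ 0 := by simpa using hpqr
      simp [hv, this] at h'
    have hq' : i q ≠ 0 := (map_ne_zero i).2 hq
    refine ⟨-r / q, 1, v, by simp, hv, ?_, by simp, by field_simp; ring⟩
    rw [map_div₀, map_neg]
    field_simp
    linear_combination h'
  · have hp' : i p ≠ 0 := (map_ne_zero i).2 hp
    have h2' : (2 : E) ≠ 0 := by
      have := (map_ne_zero i).2 h2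
      rwa [map_ofNat] at this
    obtain ⟨s, hs⟩ : IsSquare (q ^ 2 - 4 * p * r) := by
      apply hE
      refine ⟨(2 * i p * u + i q * v) / v, ?_⟩
      rw [map_sub, map_pow, map_mul, map_mul, map_ofNat]
      field_simp
      linear_combination -4 * i p * h
    have hs' : i q ^ 2 - 4 * i p * i r = i s * i s := by
      have := congrArg i hs
      simpa only [map_sub, map_pow, map_mul, map_ofNat] using this
    have hfac : (2 * i p * u + i q * v - i s * v) * (2 * i p * u + i q * v + i s * v) = 0 := by
      linear_combination 4 * i p * h + v ^ 2 * hs'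
    obtain ⟨s, hs, hu⟩ : ∃ s, q ^ 2 - 4 * p * r = s * s ∧ 2 * i p * u + i q * v - i s * v = 0 := by
      rcases mul_eq_zero.1 hfac with h | h
      · exact ⟨s, hs, h⟩
      · exact ⟨-s, by rw [hs]; ring, by rw [map_neg]; linear_combination h⟩
    refine ⟨(s - q) / (2 * p), 1, v, by simp, hv, ?_, by simp, ?_⟩
    · rw [map_div₀, map_sub, map_mul, map_ofNat]
      field_simp
      linear_combination hu
    · field_simp
      linear_combination -hs

variable [Fintype F]

lemma pow_card_div_two_of_not_isSquare (hodd : Odd (Fintype.card F)) {a : F}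
    (ha : ¬ IsSquare a) : a ^ (Fintype.card F / 2) = -1 := by
  have hchar := ringChar_ne_two_of_odd_card hodd
  have ha0 : a ≠ 0 := by rintro rfl; exact ha (IsSquare.zero)
  exact (FiniteField.pow_dichotomy hchar ha0).resolve_left
    (fun h => ha ((FiniteField.isSquare_iff hchar ha0).2 h))

lemma isSquare_mul_of_not_isSquare (hodd : Odd (Fintype.card F)) {a b : F}
    (ha : ¬ IsSquare a) (hb : ¬ IsSquare b) : IsSquare (a * b) := by
  have ha0 : a ≠ 0 := by rintro rfl; exact ha (IsSquare.zero)
  have hb0 : b ≠ 0 := by rintro rfl; exact hb (IsSquare.zero)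
  rw [FiniteField.isSquare_iff (ringChar_ne_two_of_odd_card hodd) (mul_ne_zero ha0 hb0), mul_pow,
    pow_card_div_two_of_not_isSquare hodd ha, pow_card_div_two_of_not_isSquare hodd hb]
  ring

/-- A polynomial of degree at most two with only nonsquare values on a finite field of odd order
is constant. -/
lemma eq_zero_of_quadratic_not_isSquare (hodd : Odd (Fintype.card F)) {a b c : F}
    (h : ∀ t, ¬ IsSquare (a * t ^ 2 + b * t + c)) : a = 0 ∧ b = 0 := by
  have ha : a = 0 := by
    by_contra ha
    obtain ⟨x, t, hxt⟩ := FiniteField.exists_root_sum_quadratic (f := (X ^ 2 : F[X]))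
      (g := C (-a) * X ^ 2 + C (-b) * X + C (-c)) (degree_X_pow 2)
      (degree_quadratic (neg_ne_zero.2 ha)) (Nat.odd_iff.1 hodd)
    refine h t ⟨x, ?_⟩
    simp at hxt
    linear_combination -hxt
  refine ⟨ha, ?_⟩
  by_contra hb
  apply h (-c / b)
  rw [ha]
  field_simp
  simp

/-- If every member of a pencil of cubic forms over a finite field of odd order has nonsquare
discriminant or is a cube, then the discriminant is a constant times a square. -/
theorem exists_discrIsConstMulSq (hodd : Odd (Fintype.card F)) {P Q : Cubic F}
    (H : ∀ u v : F, (u ≠ 0 ∨ v ≠ 0) →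
      ¬ IsSquare (cubicPencil P Q u v).discr ∨ IsCubeForm (cubicPencil P Q u v)) :
    ∃ c p q r, DiscrIsConstMulSq P Q c p q r := by
  have h2 : (2 : F) ≠ 0 := two_ne_zero_of_odd_card hodd
  by_cases hcube : ∃ u₀ v₀, (u₀ ≠ 0 ∨ v₀ ≠ 0) ∧ IsCubeForm (cubicPencil P Q u₀ v₀)
  · obtain ⟨u₀, v₀, h0, hc0⟩ := hcube
    by_cases hcube' : ∃ u₁ v₁, u₀ * v₁ - u₁ * v₀ ≠ 0 ∧ IsCubeForm (cubicPencil P Q u₁ v₁)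
    · obtain ⟨u₁, v₁, hδ, hc1⟩ := hcube'
      obtain ⟨k, x₀, y₀, -, -, hP⟩ := hc0
      obtain ⟨k', x₁, y₁, -, -, hQ⟩ := hc1
      have : DiscrIsConstMulSq (cubicPencil P Q u₀ v₀) (cubicPencil P Q u₁ v₁)
          (-27 * k ^ 2 * k' ^ 2 * (x₀ * y₁ - x₁ * y₀) ^ 6) 0 1 0 := by
        intro K _ _ u v
        have hmap : ∀ k x y : F, (cubeCubic k x y).map (algebraMap F K) =
            cubeCubic (algebraMap F K k) (algebraMap F K x) (algebraMap F K y) := by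
          intro k x y
          ext <;> simp [Cubic.map, cubeCubic, map_ofNat]
        rw [hP, hQ, hmap, hmap, discr_cubicPencil_cubeCubic]
        simp [map_ofNat]
      exact ⟨_, _, _, _, this.of_basis hδ⟩
    · push Not at hcube'
      obtain ⟨u₁, v₁, hδ⟩ : ∃ u₁ v₁, u₀ * v₁ - u₁ * v₀ ≠ 0 := by
        rcases h0 with h | h
        · exact ⟨0, 1, by simpa using h⟩
        · exact ⟨1, 0, by simpa using h⟩
      have hns : ∀ s, ¬ IsSquare
          (cubicPencil (cubicPencil P Q u₀ v₀) (cubicPencil P Q u₁ v₁) s 1).discr := by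
        intro s
        have hδs : u₀ * (s * v₀ + 1 * v₁) - (s * u₀ + 1 * u₁) * v₀ ≠ 0 := by
          convert! hδ using 1; ring
        rw [cubicPencil_cubicPencil]
        refine (H _ _ ?_).resolve_right (hcube' _ _ hδs)
        by_contra! hz
        exact hδs (by rw [hz.1, hz.2]; ring)
      obtain ⟨k, x₀, y₀, -, -, hP⟩ := hc0
      have h4 : (cubicPencil P Q u₀ v₀).discr = 0 := by rw [hP, discr_cubeCubic]
      have h3 : discrPolar (cubicPencil P Q u₀ v₀) (cubicPencil P Q u₁ v₁) = 0 := by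
        rw [hP, discrPolar_cubeCubic]
      clear hP
      set P' := cubicPencil P Q u₀ v₀
      set Q' := cubicPencil P Q u₁ v₁
      obtain ⟨hA, hB⟩ := eq_zero_of_quadratic_not_isSquare hodd
        (a := (cubicPencil P' Q' 1 1).discr - P'.discr - Q'.discr - discrPolar P' Q'
          - discrPolar Q' P') (b := discrPolar Q' P') (c := Q'.discr) (fun t => by
            have := hns t
            rw [discr_cubicPencil] at this
            convert! this using 2
            rw [h4, h3]; ring)
      have : DiscrIsConstMulSq P' Q' Q'.discr 0 0 1 :=
        discrIsConstMulSq_of_coeff (by rw [h4]; ring) (by rw [h3]; ring) (by rw [hA]; ring)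
          (by rw [hB]; ring) (by ring)
      exact ⟨_, _, _, _, this.of_basis hδ⟩
  · push Not at hcube
    have hns := fun u v h => (H u v h).resolve_right (hcube u v h)
    have ha : ¬ IsSquare P.discr := by
      have := hns 1 0 (by simp)
      rw [discr_cubicPencil] at this
      simpa using this
    have ha0 : P.discr ≠ 0 := fun h => ha (h ▸ IsSquare.zero)
    set a := P.discr
    set b := discrPolar P Q
    set c := (cubicPencil P Q 1 1).discr - P.discr - Q.discr - discrPolar P Q - discrPolar Q P
    set d := discrPolar Q P
    set e := Q.discr
    obtain ⟨I1, I2⟩ := quartic_eq_square_of_isSquare_values hodd (a := a * a) (b := a * b)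
      (c := a * c) (d := a * d) (e := a * e) (mul_ne_zero ha0 ha0) ⟨a, rfl⟩ (fun t => by
        have ht := hns t 1 (by simp)
        rw [discr_cubicPencil] at ht
        have : a * a * t ^ 4 + a * b * t ^ 3 + a * c * t ^ 2 + a * d * t + a * e =
            a * (a * t ^ 4 + b * t ^ 3 * 1 + c * t ^ 2 * 1 ^ 2 + d * t * 1 ^ 3 + e * 1 ^ 4) := by
          ring
        rw [this]
        exact ⟨mul_ne_zero ha0 (fun h => ht (h ▸ IsSquare.zero)),
          isSquare_mul_of_not_isSquare hodd ha ht⟩)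
    have J1 : 8 * a ^ 2 * d = b * (4 * a * c - b ^ 2) := by
      apply mul_left_cancel₀ (pow_ne_zero 3 ha0); linear_combination I1
    have J2 : 64 * a ^ 3 * e = (4 * a * c - b ^ 2) ^ 2 := by
      apply mul_left_cancel₀ (pow_ne_zero 4 ha0); linear_combination I2
    have h8 : (8 : F) ≠ 0 := by
      rw [show (8 : F) = 2 ^ 3 by norm_num]; exact pow_ne_zero 3 h2
    have h64 : (64 : F) ≠ 0 := by
      rw [show (64 : F) = 2 ^ 6 by norm_num]; exact pow_ne_zero 6 h2
    refine ⟨a, 1, b / (2 * a), (4 * a * c - b ^ 2) / (8 * a ^ 2), discrIsConstMulSq_of_coeff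
      (by ring_nf; rfl) ?_ ?_ ?_ ?_⟩
    · change b = _
      field_simp
    · change c = _
      field_simp
      ring
    · change d = _
      have : d = b * (4 * a * c - b ^ 2) / (8 * a ^ 2) := by
        rw [eq_div_iff (mul_ne_zero h8 (pow_ne_zero 2 ha0))]; linear_combination J1
      rw [this]
      field_simp
    · change e = _
      have : e = (4 * a * c - b ^ 2) ^ 2 / (64 * a ^ 3) := by
        rw [eq_div_iff (mul_ne_zero h64 (pow_ne_zero 3 ha0))]; linear_combination J2
      rw [this]
      field_simp
      norm_num

lemma isSquare_algebraMap_iff (hodd : Odd (Fintype.card F)) {E : Type*} [Field E] [Algebra F E]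
    [Fintype E] {n : ℕ} (hcard : Fintype.card E = Fintype.card F ^ n) {a : F}
    (ha : ¬ IsSquare a) : IsSquare (algebraMap F E a) ↔ Even n := by
  have ha0 : a ≠ 0 := by rintro rfl; exact ha IsSquare.zero
  have hoddE : Odd (Fintype.card E) := hcard ▸ hodd.pow
  have h2E : (2 : E) ≠ 0 := two_ne_zero_of_odd_card hoddE
  have hS : ∀ k, ∃ S, Fintype.card F ^ k = 2 * (Fintype.card F / 2 * S) + 1 ∧ (Odd S ↔ Odd k) := by
    obtain ⟨m, hm⟩ := hodd
    have hm' : Fintype.card F / 2 = m := by omega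
    rw [hm']
    intro k
    induction k with
    | zero => exact ⟨0, by simp, by simp⟩
    | succ k ih =>
      obtain ⟨S, h1, h3⟩ := ih
      refine ⟨Fintype.card F * S + 1, ?_, ?_⟩
      · rw [pow_succ, h1, hm]; ring
      · rw [Nat.odd_add_one, Nat.odd_add_one, Nat.odd_mul, hm, h3]
        simp
  obtain ⟨S, h1, h3⟩ := hS n
  have hdiv : Fintype.card E / 2 = Fintype.card F / 2 * S := by omega
  rw [FiniteField.isSquare_iff (ringChar_ne_two_of_odd_card hoddE)
    ((_root_.map_ne_zero _).2 ha0), hdiv,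
    pow_mul, ← map_pow, pow_card_div_two_of_not_isSquare hodd ha, map_neg, map_one,
    ← Nat.not_odd_iff_even, ← h3, Nat.not_odd_iff_even]
  have hne : (-1 : E) ≠ 1 := fun h => h2E (by linear_combination -h)
  exact neg_one_pow_eq_one_iff_even hne

section Extension

variable {P Q : Cubic F}

/-- A pencil all of whose members have exactly one zero over `F`. -/
def PencilPermutes {K : Type*} [Field K] (P Q : Cubic K) : Prop :=
  ∀ u v : K, (u ≠ 0 ∨ v ≠ 0) → AtMostOneZero (cubicPencil P Q u v) ∧
    ∃ x y, (x ≠ 0 ∨ y ≠ 0) ∧ cubicForm (cubicPencil P Q u v) x y = 0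

lemma PencilPermutes.isCubeForm {K : Type*} [Field K] {P Q : Cubic K} (h2 : (2 : K) ≠ 0)
    (H : PencilPermutes P Q) {u v : K} (huv : u ≠ 0 ∨ v ≠ 0)
    (hsq : IsSquare (cubicPencil P Q u v).discr) : IsCubeForm (cubicPencil P Q u v) := by
  obtain ⟨h1, x, y, hxy, hz⟩ := H u v huv
  exact isCubeForm_of_isSquare_discr h2 hxy hz h1 hsq

/-- The discriminant of a permuting pencil with nonzero discriminant is a nonsquare constant times
the square of a nonzero quadratic form. -/
lemma PencilPermutes.exists_discr_eq (hodd : Odd (Fintype.card F)) (H : PencilPermutes P Q)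
    (hD : ∃ (K : Type w) (_ : Field K) (_ : Algebra F K) (u v : K),
      (cubicPencil (P.map (algebraMap F K)) (Q.map (algebraMap F K)) u v).discr ≠ 0) :
    ∃ c p q r, ¬ IsSquare c ∧ (p ≠ 0 ∨ q ≠ 0 ∨ r ≠ 0) ∧ DiscrIsConstMulSq P Q c p q r := by
  have h2 : (2 : F) ≠ 0 := two_ne_zero_of_odd_card hodd
  obtain ⟨c, p, q, r, h⟩ := exists_discrIsConstMulSq hodd (P := P) (Q := Q)
    (fun u v huv => or_iff_not_imp_left.2 fun hs => H.isCubeForm h2 huv (not_not.1 hs))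
  obtain ⟨K, _, _, u, v, hne⟩ := hD
  rw [h K u v] at hne
  have hpqr : p ≠ 0 ∨ q ≠ 0 ∨ r ≠ 0 := by
    by_contra! hc
    simp [hc.1, hc.2.1, hc.2.2] at hne
  have hc0 : c ≠ 0 := by rintro rfl; simp at hne
  refine ⟨c, p, q, r, fun hc => ?_, hpqr, h⟩
  obtain ⟨u, v, huv, hval⟩ := exists_quadraticForm_ne_zero hpqr
  have hd : (cubicPencil P Q u v).discr = c * (p * u ^ 2 + q * u * v + r * v ^ 2) ^ 2 := h F u v
  have := (H.isCubeForm h2 huv (by rw [hd]; exact hc.mul (IsSquare.sq _))).discr_eq_zero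
  rw [hd] at this
  exact mul_ne_zero hc0 (pow_ne_zero 2 hval) this

variable {E : Type w} [Field E] [Algebra F E] [Fintype E] {n : ℕ}

theorem PencilPermutes.atMostOneZero_of_odd (hodd : Odd (Fintype.card F)) (H : PencilPermutes P Q)
    (hD : ∃ (K : Type w) (_ : Field K) (_ : Algebra F K) (u v : K),
      (cubicPencil (P.map (algebraMap F K)) (Q.map (algebraMap F K)) u v).discr ≠ 0)
    (hcard : Fintype.card E = Fintype.card F ^ n) (hn : Odd n) {u v : E} (huv : u ≠ 0 ∨ v ≠ 0) :
    AtMostOneZero (cubicPencil (P.map (algebraMap F E)) (Q.map (algebraMap F E)) u v) := by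
  have h2 : (2 : F) ≠ 0 := two_ne_zero_of_odd_card hodd
  obtain ⟨c, p, q, r, hc, hpqr, h⟩ := H.exists_discr_eq hodd hD
  have hE : ∀ a : F, IsSquare (algebraMap F E a) → IsSquare a := fun a ha => by
    by_contra hns
    exact Nat.not_even_iff_odd.2 hn ((isSquare_algebraMap_iff hodd hcard hns).1 ha)
  by_cases hz : algebraMap F E p * u ^ 2 + algebraMap F E q * u * v + algebraMap F E r * v ^ 2 = 0
  · obtain ⟨u₀, v₀, t, h0, ht, rfl, rfl, hz₀⟩ := exists_zero_of_zero_extension h2 hE hpqr huv hz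
    have hd : (cubicPencil P Q u₀ v₀).discr = 0 := by
      have hd' : (cubicPencil P Q u₀ v₀).discr = c * (p * u₀ ^ 2 + q * u₀ * v₀ + r * v₀ ^ 2) ^ 2 :=
        h F u₀ v₀
      rw [hd', hz₀, zero_pow two_ne_zero, mul_zero]
    have hcube := ((H.isCubeForm h2 h0 (by rw [hd]; exact IsSquare.zero)).map
      (algebraMap F E)).atMostOneZero
    rw [map_cubicPencil] at hcube
    intro x y x' y' hxy hxy' hx hx'
    refine hcube x y x' y' hxy hxy' ?_ ?_
    all_goals rw [cubicForm_cubicPencil] at *; apply mul_left_cancel₀ ht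
    · linear_combination hx
    · linear_combination hx'
  · refine atMostOneZero_of_not_isSquare_discr fun hs => hc (hE c ?_)
    obtain ⟨s, hs⟩ := hs
    rw [h E u v] at hs
    exact ⟨s / (algebraMap F E p * u ^ 2 + algebraMap F E q * u * v + algebraMap F E r * v ^ 2), by
      rw [div_mul_div_comm, ← hs, ← sq, mul_div_cancel_right₀ _ (pow_ne_zero 2 hz)]⟩

theorem PencilPermutes.not_of_even (hodd : Odd (Fintype.card F)) (H : PencilPermutes P Q)
    (hD : ∃ (K : Type w) (_ : Field K) (_ : Algebra F K) (u v : K),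
      (cubicPencil (P.map (algebraMap F K)) (Q.map (algebraMap F K)) u v).discr ≠ 0)
    (hcard : Fintype.card E = Fintype.card F ^ n) (hn : Even n) :
    ¬ PencilPermutes (P.map (algebraMap F E)) (Q.map (algebraMap F E)) := by
  intro HE
  have h2E : (2 : E) ≠ 0 := two_ne_zero_of_odd_card (hcard ▸ hodd.pow)
  obtain ⟨c, p, q, r, hc, hpqr, h⟩ := H.exists_discr_eq hodd hD
  have hc0 : c ≠ 0 := by rintro rfl; exact hc IsSquare.zero
  obtain ⟨u, v, huv, hval⟩ := exists_quadraticForm_ne_zero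
    (p := algebraMap F E p) (q := algebraMap F E q) (r := algebraMap F E r) (by simpa using hpqr)
  have hcE := (isSquare_algebraMap_iff hodd hcard hc).2 hn
  have := (HE.isCubeForm h2E huv (by rw [h E]; exact hcE.mul (IsSquare.sq _))).discr_eq_zero
  rw [h E] at this
  exact mul_ne_zero ((_root_.map_ne_zero _).2 hc0) (pow_ne_zero 2 hval) this

end Extension

end Pencil

section RatEval

/-- Homogeneous coordinates of a point of the projective line. -/
def projCoords {K : Type*} [Field K] : Option K → K × K
  | some a => (a, 1)
  | none => (1, 0)

/-- The cubic made of the coefficients of degree at most three of a polynomial. -/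
def cubicOfPoly {K : Type*} [Field K] (f : K[X]) : Cubic K :=
  ⟨f.coeff 3, f.coeff 2, f.coeff 1, f.coeff 0⟩

variable {K : Type} [Field K]

lemma projCoords_ne_zero (x : Option K) : (projCoords x).1 ≠ 0 ∨ (projCoords x).2 ≠ 0 := by
  cases x <;> simp [projCoords]

lemma exists_smul_projCoords {x y : K} (h : x ≠ 0 ∨ y ≠ 0) :
    ∃ (p : Option K) (t : K), t ≠ 0 ∧ x = t * (projCoords p).1 ∧ y = t * (projCoords p).2 := by
  by_cases hy : y = 0
  · exact ⟨none, x, h.resolve_right (not_not.2 hy), by simp [projCoords], by simp [projCoords, hy]⟩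
  · exact ⟨some (x / y), y, hy, by simp [projCoords, mul_div_cancel₀, hy], by simp [projCoords]⟩

lemma projCoords_injective {p p' : Option K}
    (h : (projCoords p).1 * (projCoords p').2 = (projCoords p').1 * (projCoords p).2) : p = p' := by
  cases p <;> cases p' <;> simp_all [projCoords]

lemma cubicForm_mul (P : Cubic K) (t x y : K) :
    cubicForm P (t * x) (t * y) = t ^ 3 * cubicForm P x y := by
  simp only [cubicForm]; ring

lemma toPoly_cubicOfPoly {f : K[X]} (hf : f.natDegree ≤ 3) : (cubicOfPoly f).toPoly = f := by
  conv_rhs => rw [f.as_sum_range' 4 (by omega)]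
  simp only [Cubic.toPoly, cubicOfPoly, Finset.sum_range_succ, ← C_mul_X_pow_eq_monomial]
  simp
  ring

lemma cubicOfPoly_map {L : Type*} [Field L] (i : K →+* L) (f : K[X]) :
    cubicOfPoly (f.map i) = (cubicOfPoly f).map i := by
  simp [cubicOfPoly, Cubic.map]

lemma cubicForm_cubicOfPoly_one {f : K[X]} (hf : f.natDegree ≤ 3) (a : K) :
    cubicForm (cubicOfPoly f) a 1 = f.eval a := by
  conv_rhs => rw [← toPoly_cubicOfPoly hf]
  simp [cubicForm, Cubic.toPoly]

lemma cubicForm_cubicOfPoly_infty (f : K[X]) :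
    cubicForm (cubicOfPoly f) 1 0 = f.coeff 3 := by
  simp [cubicForm, cubicOfPoly]

variable {f g : K[X]}

lemma coeff_three_ne_zero (hdeg : max f.natDegree g.natDegree = 3) :
    f.coeff 3 ≠ 0 ∨ g.coeff 3 ≠ 0 := by
  rcases max_choice f.natDegree g.natDegree with h | h <;> rw [hdeg] at h
  · left; rw [h]; exact leadingCoeff_ne_zero.2 (by rintro rfl; simp at h)
  · right; rw [h]; exact leadingCoeff_ne_zero.2 (by rintro rfl; simp at h)

lemma cubicForm_projCoords_ne_zero (hfg : IsCoprime f g)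
    (hdeg : max f.natDegree g.natDegree = 3) (x : Option K) :
    cubicForm (cubicOfPoly f) (projCoords x).1 (projCoords x).2 ≠ 0 ∨
      cubicForm (cubicOfPoly g) (projCoords x).1 (projCoords x).2 ≠ 0 := by
  have hf : f.natDegree ≤ 3 := hdeg ▸ le_max_left _ _
  have hg : g.natDegree ≤ 3 := hdeg ▸ le_max_right _ _
  cases x with
  | none => simpa only [projCoords, cubicForm_cubicOfPoly_infty] using coeff_three_ne_zero hdeg
  | some a =>
    simp only [projCoords, cubicForm_cubicOfPoly_one hf, cubicForm_cubicOfPoly_one hg]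
    by_contra! h
    obtain ⟨r, s, hrs⟩ := hfg
    simpa [h.1, h.2] using congrArg (eval a) hrs

/-- In homogeneous coordinates `ratEval f g` is given by the forms of `f` and `g`. -/
lemma projCoords_ratEval (hfg : IsCoprime f g) (hdeg : max f.natDegree g.natDegree = 3)
    (x : Option K) : ∃ t : K, t ≠ 0 ∧
      cubicForm (cubicOfPoly f) (projCoords x).1 (projCoords x).2 =
        t * (projCoords (ratEval f g x)).1 ∧
      cubicForm (cubicOfPoly g) (projCoords x).1 (projCoords x).2 =
        t * (projCoords (ratEval f g x)).2 := by
  have hf : f.natDegree ≤ 3 := hdeg ▸ le_max_left _ _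
  have hg : g.natDegree ≤ 3 := hdeg ▸ le_max_right _ _
  have hne := cubicForm_projCoords_ne_zero hfg hdeg x
  cases x with
  | none =>
    simp only [projCoords, cubicForm_cubicOfPoly_infty] at hne ⊢
    simp only [ratEval]
    split_ifs with h1 h2
    · have h0 : g.coeff 3 = 0 := coeff_eq_zero_of_natDegree_lt (by omega)
      exact ⟨f.coeff 3, by tauto, by simp, by simp [h0]⟩
    · have h0 : f.coeff 3 = 0 := coeff_eq_zero_of_natDegree_lt (by omega)
      exact ⟨g.coeff 3, by tauto, by simp [h0], by simp⟩
    · have hf3 : f.natDegree = 3 := by omega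
      have hg3 : g.natDegree = 3 := by omega
      have h0 : g.coeff 3 ≠ 0 := by
        rw [← hg3]; exact leadingCoeff_ne_zero.2 (by rintro rfl; simp at hg3)
      refine ⟨g.coeff 3, h0, ?_, by simp⟩
      simp [leadingCoeff, hf3, hg3, mul_div_cancel₀ _ h0]
  | some a =>
    simp only [projCoords, cubicForm_cubicOfPoly_one hf, cubicForm_cubicOfPoly_one hg] at hne ⊢
    simp only [ratEval]
    split_ifs with h
    · exact ⟨g.eval a, h, by simp [mul_div_cancel₀ _ h], by simp⟩
    · rw [not_not] at h
      exact ⟨f.eval a, by tauto, by simp, by simp [h]⟩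

lemma pencilPermutes_of_bijective (hfg : IsCoprime f g)
    (hdeg : max f.natDegree g.natDegree = 3) (h : Function.Bijective (ratEval f g)) :
    PencilPermutes (cubicOfPoly f) (cubicOfPoly g) := by
  intro u v huv
  constructor
  · intro x y x' y' hxy hxy' hx hx'
    obtain ⟨p, t, ht, rfl, rfl⟩ := exists_smul_projCoords hxy
    obtain ⟨p', t', ht', rfl, rfl⟩ := exists_smul_projCoords hxy'
    suffices p = p' by subst this; ring
    rw [cubicForm_mul, mul_eq_zero, or_iff_right (pow_ne_zero 3 ht), cubicForm_cubicPencil] at hx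
    rw [cubicForm_mul, mul_eq_zero, or_iff_right (pow_ne_zero 3 ht'), cubicForm_cubicPencil] at hx'
    obtain ⟨s, hs, h1, h2⟩ := projCoords_ratEval hfg hdeg p
    obtain ⟨s', hs', h1', h2'⟩ := projCoords_ratEval hfg hdeg p'
    rw [h1, h2] at hx
    rw [h1', h2'] at hx'
    refine h.1 (projCoords_injective ?_)
    have e : u * (projCoords (ratEval f g p)).1 + v * (projCoords (ratEval f g p)).2 = 0 :=
      mul_left_cancel₀ hs (by linear_combination hx)
    have e' : u * (projCoords (ratEval f g p')).1 + v * (projCoords (ratEval f g p')).2 = 0 :=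
      mul_left_cancel₀ hs' (by linear_combination hx')
    rcases huv with hu | hv
    · apply mul_left_cancel₀ hu
      linear_combination (projCoords (ratEval f g p')).2 * e - (projCoords (ratEval f g p)).2 * e'
    · apply mul_left_cancel₀ hv
      linear_combination (projCoords (ratEval f g p)).1 * e' - (projCoords (ratEval f g p')).1 * e
  · obtain ⟨p, t, ht, hv, hu⟩ := exists_smul_projCoords (x := -v) (y := u) (by
      rw [neg_ne_zero]; exact huv.symm)
    obtain ⟨x, rfl⟩ := h.2 p
    obtain ⟨s, hs, h1, h2⟩ := projCoords_ratEval hfg hdeg x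
    refine ⟨_, _, projCoords_ne_zero x, ?_⟩
    rw [cubicForm_cubicPencil, h1, h2, hu, ← neg_neg v, hv]
    ring

lemma ratEval_injective (hfg : IsCoprime f g) (hdeg : max f.natDegree g.natDegree = 3)
    (h : ∀ u v : K, (u ≠ 0 ∨ v ≠ 0) →
      AtMostOneZero (cubicPencil (cubicOfPoly f) (cubicOfPoly g) u v)) :
    Function.Injective (ratEval f g) := by
  intro p p' hpp
  obtain ⟨s, hs, h1, h2⟩ := projCoords_ratEval hfg hdeg p
  obtain ⟨s', hs', h1', h2'⟩ := projCoords_ratEval hfg hdeg p'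
  refine projCoords_injective (h (projCoords (ratEval f g p)).2 (-(projCoords (ratEval f g p)).1)
    (by rw [neg_ne_zero]; exact (projCoords_ne_zero _).symm) _ _ _ _ (projCoords_ne_zero p)
    (projCoords_ne_zero p') ?_ ?_)
  · rw [cubicForm_cubicPencil, h1, h2]; ring
  · rw [cubicForm_cubicPencil, h1', h2', hpp]; ring

lemma discr_ne_zero_of_separable {L : Type*} [Field L] {P : Cubic L} (ha : P.a ≠ 0)
    (hP : P.toPoly.Separable) : P.discr ≠ 0 := by
  rw [Cubic.discr_ne_zero_iff_roots_nodup ha (φ := algebraMap L (AlgebraicClosure L))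
    (IsAlgClosed.splits _), Cubic.map_roots]
  exact nodup_roots hP.map

lemma exists_discr_ne_zero_of_fiberPoly_separable (hdeg : max f.natDegree g.natDegree = 3)
    (hsep : (fiberPoly f g).Separable) :
    (cubicPencil ((cubicOfPoly f).map (algebraMap K (RatFunc K)))
      ((cubicOfPoly g).map (algebraMap K (RatFunc K))) 1 (-RatFunc.X)).discr ≠ 0 := by
  have hf : f.natDegree ≤ 3 := hdeg ▸ le_max_left _ _
  have hg : g.natDegree ≤ 3 := hdeg ▸ le_max_right _ _
  apply discr_ne_zero_of_separable
  · have hX : algebraMap K[X] (RatFunc K) (C (f.coeff 3) - X * C (g.coeff 3)) ≠ 0 := by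
      rw [Ne, FaithfulSMul.algebraMap_eq_zero_iff]
      intro h
      have h0 := congrArg (coeff · 0) h
      have h1 := congrArg (coeff · 1) h
      simp [coeff_C] at h0 h1
      exact (coeff_three_ne_zero hdeg).elim (· h0) (· h1)
    convert hX using 1
    simp [cubicPencil, cubicOfPoly, Cubic.map, RatFunc.algebraMap_C, RatFunc.algebraMap_X,
      RatFunc.algebraMap_eq_C]
    ring
  · convert hsep using 1
    rw [fiberPoly]
    conv_rhs => rw [← toPoly_cubicOfPoly hf, ← toPoly_cubicOfPoly hg]
    simp [cubicPencil, Cubic.toPoly, Cubic.map]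
    ring

end RatEval

theorem stmt_8 (F : Type) [Field F] [Fintype F] (hodd : Odd (Fintype.card F))
    (φ : RatFunc F) (hdeg : max φ.num.natDegree φ.denom.natDegree = 3)
    (hsep : (fiberPoly φ.num φ.denom).Separable)
    (hperm : Function.Bijective (ratEval φ.num φ.denom)) :
    ∀ n : ℕ, 0 < n →
      ∀ (E : Type) [Field E] [Algebra F E] [Fintype E],
        Fintype.card E = Fintype.card F ^ n →
        (Function.Bijective
          (ratEval (φ.num.map (algebraMap F E)) (φ.denom.map (algebraMap F E))) ↔ Odd n) := by
  intro n _ E _ _ _ hcard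
  have hcop := RatFunc.isCoprime_num_denom φ
  have hcopE : IsCoprime (φ.num.map (algebraMap F E)) (φ.denom.map (algebraMap F E)) :=
    hcop.map (mapRingHom (algebraMap F E))
  have hdegE : max (φ.num.map (algebraMap F E)).natDegree (φ.denom.map (algebraMap F E)).natDegree
      = 3 := by simpa only [natDegree_map] using hdeg
  have H := pencilPermutes_of_bijective hcop hdeg hperm
  have hD : ∃ (K : Type) (_ : Field K) (_ : Algebra F K) (u v : K),
      (cubicPencil ((cubicOfPoly φ.num).map (algebraMap F K))
        ((cubicOfPoly φ.denom).map (algebraMap F K)) u v).discr ≠ 0 :=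
    ⟨RatFunc F, _, _, _, _, exists_discr_ne_zero_of_fiberPoly_separable hdeg hsep⟩
  constructor
  · intro hbij
    by_contra hn
    refine H.not_of_even hodd hD hcard (Nat.not_odd_iff_even.1 hn) ?_
    simpa only [cubicOfPoly_map] using pencilPermutes_of_bijective hcopE hdegE hbij
  · intro hn
    refine Finite.injective_iff_bijective.1 (ratEval_injective hcopE hdegE fun u v huv => ?_)
    simpa only [cubicOfPoly_map] using H.atMostOneZero_of_odd hodd hD hcard hn huv

end
end
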